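/- Polynomial estimate at φ = π/2 after contour shift: Fix η > 40, H ∈ C_η, α = (α₁, α₂, α₃) ∈ ℂ³ with Re α_i = 0 and α₁ + α₂ + α₃ = 0, δ ∈ {+1, −1}, and T ≥ 1000. Then there exist constants B > 0, C > 0, and T₀ ≥ 2 (depending on η, T, α, H) such that |(F_α^{(δ)} H)(s₀, s; π/2)| ≤ C · |Im s₀|^{8 − η/2} · (log |Im s₀|)^{B} for all (s₀, s) with Re s₀ > 1/100, Re s < 4, 2·Re s − Re s₀ − 1/100 > 0, |Im s| < T, and |Im s₀| ≥ T₀. -/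

import Mathlib

open Complex MeasureTheory Set

/-- `Γ_ℝ(s) := π^{−s/2} Γ(s/2)`. -/
noncomputable def GammaR (s : ℂ) : ℂ := (Real.pi : ℂ) ^ (-s / 2) * Complex.Gamma (s / 2)

/-- The K-Bessel function `K_μ(x) = ∫₀^∞ exp(−x cosh t) cosh(μt) dt`. -/
noncomputable def KBessel (μ : ℂ) (x : ℝ) : ℂ :=
  ∫ t in Ioi (0:ℝ), Complex.exp (-(x : ℂ) * (Real.cosh t : ℂ)) * Complex.cosh (μ * (t : ℂ))

/-- The GL(2) Whittaker function `W_μ(y) = 2√y K_μ(2πy)`. -/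
noncomputable def W2 (μ : ℂ) (y : ℝ) : ℂ :=
  2 * (Real.sqrt y : ℂ) * KBessel μ (2 * Real.pi * y)

/-- The class `C_η` of test functions. -/
def MemCeta (η : ℝ) (H : ℂ → ℂ) : Prop :=
  DifferentiableOn ℂ H {μ : ℂ | |μ.re| < 2 * η} ∧
  (∀ μ : ℂ, |μ.re| < 2 * η → H (-μ) = H μ) ∧
  ∃ C : ℝ, ∀ μ : ℂ, |μ.re| < 2 * η → ‖H μ‖ ≤ C * Real.exp (-2 * Real.pi * |μ.im|)

/-- The inverse Kontorovich–Lebedev transform. -/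
noncomputable def Hflat (H : ℂ → ℂ) (y : ℝ) : ℂ :=
  (1 / (4 * (Real.pi : ℂ))) * ∫ t : ℝ,
    H (t * I) * W2 (t * I) y / (Complex.Gamma (t * I) * Complex.Gamma (-(t * I)))

/-- Mellin transform `ĥ(w) := ∫₀^∞ h(y) y^{w−1} dy`. -/
noncomputable def mellinT (h : ℝ → ℂ) (w : ℂ) : ℂ :=
  ∫ y in Ioi (0:ℝ), h y * (y : ℂ) ^ (w - 1)

/-- The Mellin kernel `G_α(s₀,s₁)` of the GL(3) Whittaker function. -/
noncomputable def Gfun (α : Fin 3 → ℂ) (s0 s1 : ℂ) : ℂ :=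
  (∏ i, GammaR (s0 + α i) * GammaR (s1 - α i)) / GammaR (s0 + s1)

/-- The Gamma-kernel `𝒢_α^{(δ)}(s₁, u; s₀, s; φ)` of the archimedean transform. -/
noncomputable def GkerPhi (α : Fin 3 → ℂ) (δ φ : ℝ) (s1 u s0 s : ℂ) : ℂ :=
  Gfun α (s0 - u) s1 * (2 * (Real.pi : ℂ)) ^ (-u) *
    Complex.exp (Complex.I * δ * φ * u) * Complex.Gamma u *
    Complex.Gamma ((u + 1 - 2 * s + s1 - s0) / 2) *
    Complex.Gamma ((2 * s - s0 - u) / 2) / Complex.Gamma ((1 + s1) / 2 - s0)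

/-- The archimedean transform `(F_α^{(δ)} H)(s₀, s; φ)`, a double integral over
`s₁ = 15 + it₁` and `u = 1/100 + iv`. -/
noncomputable def FtransPhi (α : Fin 3 → ℂ) (δ φ : ℝ) (H : ℂ → ℂ) (s0 s : ℂ) : ℂ :=
  (1 / (2 * (Real.pi : ℂ))) ^ 2 *
    ∫ t1 : ℝ, ∫ v : ℝ,
      mellinT (Hflat H) (s - (15 + t1 * Complex.I) - 1/2) *
        GkerPhi α δ φ (15 + t1 * Complex.I) (1/100 + v * Complex.I) s0 s


/-! ### Bounds for the Gamma function on vertical strips -/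

/-- The ratio `|Γ(z)| / Γ(Re z)` does not decrease when `z` moves to the right. -/
lemma norm_Gamma_mul_Gamma_le {z : ℂ} {b : ℝ} (hz : 0 < z.re) (hb : 0 ≤ b) :
    ‖Complex.Gamma z‖ * Real.Gamma (z.re + b) ≤ Real.Gamma z.re * ‖Complex.Gamma (z + b)‖ := by
  rcases hb.eq_or_lt with rfl | hb
  · simp [mul_comm]
  have h1 := Complex.Gamma_mul_Gamma_eq_betaIntegral (s := z) (t := b) hz (by simpa using hb)
  have h2 := Complex.Gamma_mul_Gamma_eq_betaIntegral (s := (z.re : ℂ)) (t := b) (by simpa using hz)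
    (by simpa using hb)
  have hGb : 0 < Real.Gamma b := Real.Gamma_pos_of_pos hb
  have hGzb : 0 < Real.Gamma (z.re + b) := Real.Gamma_pos_of_pos (by positivity)
  have hGz : 0 < Real.Gamma z.re := Real.Gamma_pos_of_pos hz
  have hB : ‖Complex.betaIntegral z b‖ ≤ (Complex.betaIntegral (z.re : ℂ) b).re := by
    have hreal : Complex.betaIntegral (z.re : ℂ) b =
        ((∫ x in (0:ℝ)..1, x ^ (z.re - 1) * (1 - x) ^ (b - 1) : ℝ) : ℂ) := by
      rw [Complex.betaIntegral, ← intervalIntegral.integral_ofReal]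
      refine intervalIntegral.integral_congr fun x hx => ?_
      rw [uIcc_of_le zero_le_one] at hx
      have h1x : 0 ≤ 1 - x := by linarith [hx.2]
      simp only [Complex.ofReal_mul, Complex.ofReal_cpow hx.1, Complex.ofReal_cpow h1x]
      push_cast
      rfl
    rw [hreal, Complex.ofReal_re, Complex.betaIntegral]
    refine (intervalIntegral.norm_integral_le_integral_norm zero_le_one).trans (le_of_eq ?_)
    refine intervalIntegral.integral_congr_Ioo_of_le zero_le_one fun x hx => ?_
    have h1x : 0 < 1 - x := by linarith [hx.2]
    have h1x' : (1 - (x : ℂ)) = ((1 - x : ℝ) : ℂ) := by push_cast; ring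
    simp only [norm_mul]
    rw [Complex.norm_cpow_eq_rpow_re_of_pos hx.1, h1x', Complex.norm_cpow_eq_rpow_re_of_pos h1x]
    simp
  have h2' : Real.Gamma z.re * Real.Gamma b =
      Real.Gamma (z.re + b) * (Complex.betaIntegral (z.re : ℂ) b).re := by
    have := congrArg Complex.re h2
    rw [← Complex.ofReal_add, Complex.Gamma_ofReal, Complex.Gamma_ofReal, Complex.Gamma_ofReal,
      ← Complex.ofReal_mul, Complex.ofReal_re, Complex.re_ofReal_mul] at this
    exact this
  have h1' := congrArg norm h1
  rw [norm_mul, norm_mul, Complex.Gamma_ofReal, Complex.norm_real,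
    Real.norm_of_nonneg hGb.le] at h1'
  have hmain : (‖Complex.Gamma z‖ * Real.Gamma (z.re + b)) * Real.Gamma b ≤
      (Real.Gamma z.re * ‖Complex.Gamma (z + b)‖) * Real.Gamma b := by
    calc _ = ‖Complex.Gamma (z + b)‖ * Real.Gamma (z.re + b) * ‖Complex.betaIntegral z b‖ := by
          rw [mul_right_comm, h1']; ring
      _ ≤ ‖Complex.Gamma (z + b)‖ * Real.Gamma (z.re + b) *
            (Complex.betaIntegral (z.re : ℂ) b).re := by gcongr
      _ = ‖Complex.Gamma (z + b)‖ *
            (Real.Gamma (z.re + b) * (Complex.betaIntegral (z.re : ℂ) b).re) := by ring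
      _ = _ := by rw [← h2']; ring
  exact le_of_mul_le_mul_right hmain hGb

lemma norm_Gamma_one_add_mul_I_sq {t : ℝ} (ht : t ≠ 0) :
    ‖Complex.Gamma (1 + t * I)‖ ^ 2 = Real.pi * t / Real.sinh (Real.pi * t) := by
  have htI : (t : ℂ) * I ≠ 0 := by simp [ht]
  have hconj : (starRingEnd ℂ) (1 + t * I) = 1 - t * I := by simp [sub_eq_add_neg]
  have h : ((‖Complex.Gamma (1 + t * I)‖ ^ 2 : ℝ) : ℂ) =
      ((Real.pi * t / Real.sinh (Real.pi * t) : ℝ) : ℂ) := by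
    push_cast
    rw [← Complex.mul_conj', ← Complex.Gamma_conj, hconj, add_comm, Complex.Gamma_add_one _ htI,
      mul_assoc, Complex.Gamma_mul_Gamma_one_sub, ← mul_assoc (Real.pi : ℂ), Complex.sin_mul_I]
    have hs : Complex.sinh (Real.pi * t) ≠ 0 := by
      rw [← Complex.ofReal_mul, ← Complex.ofReal_sinh]
      exact_mod_cast (Real.sinh_ne_zero.mpr (mul_ne_zero Real.pi_ne_zero ht))
    field_simp
  exact_mod_cast h

lemma exp_neg_le_norm_Gamma_one_add_mul_I (t : ℝ) :
    Real.exp (-(Real.pi / 2 * |t|)) ≤ ‖Complex.Gamma (1 + t * I)‖ := by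
  rcases eq_or_ne t 0 with rfl | ht
  · simp
  refine (sq_le_sq₀ (Real.exp_pos _).le (norm_nonneg _)).mp ?_
  rw [norm_Gamma_one_add_mul_I_sq ht]
  have hev : Real.pi * t / Real.sinh (Real.pi * t) =
      Real.pi * |t| / Real.sinh (Real.pi * |t|) := by
    rcases abs_choice t with h | h <;> rw [h]
    simp [Real.sinh_neg, neg_div_neg_eq]
  set x := Real.pi * |t| with hx
  have hxpos : 0 < x := by positivity
  rw [hev, ← Real.exp_nat_mul, le_div_iff₀ (Real.sinh_pos_iff.mpr hxpos), Real.sinh_eq]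
  have h1 : ((2 : ℕ) : ℝ) * -(Real.pi / 2 * |t|) = -x := by rw [hx]; push_cast; ring
  rw [h1]
  have h2 : Real.exp (-x) * Real.exp x = 1 := by rw [← Real.exp_add]; simp
  have h3 : 1 - 2 * x ≤ Real.exp (-x) * Real.exp (-x) := by
    rw [← Real.exp_add]; linarith [Real.add_one_le_exp (-x + -x)]
  nlinarith

lemma norm_Gamma_one_add_mul_I_le (t : ℝ) :
    ‖Complex.Gamma (1 + t * I)‖ ≤ 7 * (1 + |t|) * Real.exp (-(Real.pi / 2 * |t|)) := by
  rcases eq_or_ne t 0 with rfl | ht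
  · simp
  refine (sq_le_sq₀ (norm_nonneg _) (by positivity)).mp ?_
  rw [norm_Gamma_one_add_mul_I_sq ht]
  have hev : Real.pi * t / Real.sinh (Real.pi * t) =
      Real.pi * |t| / Real.sinh (Real.pi * |t|) := by
    rcases abs_choice t with h | h <;> rw [h]
    simp [Real.sinh_neg, neg_div_neg_eq]
  set x := Real.pi * |t| with hx
  have hxpos : 0 < x := by positivity
  rw [hev, mul_pow, ← Real.exp_nat_mul, div_le_iff₀ (Real.sinh_pos_iff.mpr hxpos), Real.sinh_eq]
  have h1 : ((2 : ℕ) : ℝ) * -(Real.pi / 2 * |t|) = -x := by rw [hx]; push_cast; ring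
  rw [h1]
  have h2 : Real.exp (-x) * Real.exp x = 1 := by rw [← Real.exp_add]; simp
  have h3 : Real.exp (-x) * Real.exp (-x) * (1 + 2 * x) ≤ 1 := by
    have h4 : Real.exp (-x) * Real.exp (-x) * Real.exp (2 * x) = 1 := by
      rw [← Real.exp_add, ← Real.exp_add]; ring_nf; simp
    have h5 : 1 + 2 * x ≤ Real.exp (2 * x) := by linarith [Real.add_one_le_exp (2 * x)]
    calc _ ≤ Real.exp (-x) * Real.exp (-x) * Real.exp (2 * x) := by gcongr
      _ = 1 := h4
  have h6 : 1 + 2 * x ≤ (7 * (1 + |t|)) ^ 2 := by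
    have : x ≤ 4 * |t| := by rw [hx]; gcongr; exact Real.pi_le_four
    nlinarith [abs_nonneg t]
  have h7 : x ≤ (1 + 2 * x) * ((1 - Real.exp (-x) * Real.exp (-x)) / 2) := by nlinarith
  have h8 : Real.exp (-x) * Real.exp (-x) ≤ 1 := by
    rw [← Real.exp_add]; exact Real.exp_le_one_iff.mpr (by linarith)
  calc x ≤ (1 + 2 * x) * ((1 - Real.exp (-x) * Real.exp (-x)) / 2) := h7
    _ ≤ (7 * (1 + |t|)) ^ 2 * ((1 - Real.exp (-x) * Real.exp (-x)) / 2) := by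
        gcongr
    _ = (7 * (1 + |t|)) ^ 2 * ((Real.exp (-x) * Real.exp x - Real.exp (-x) * Real.exp (-x)) / 2) := by
        rw [h2]
    _ = _ := by ring

lemma Gamma_natCast_add_one_add_mul_I (m : ℕ) (t : ℝ) :
    Complex.Gamma (((m + 1 : ℕ) : ℂ) + 1 + t * I) =
      ((m + 1 : ℕ) + t * I) * Complex.Gamma ((m : ℂ) + 1 + t * I) := by
  have h0 : ((m + 1 : ℕ) : ℂ) + t * I ≠ 0 := fun h => by
    have := congrArg Complex.re h
    simp at this
    norm_cast at this
  rw [add_right_comm, Complex.Gamma_add_one _ h0]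
  push_cast
  ring_nf

lemma norm_Gamma_natCast_le (m : ℕ) : ∃ C : ℝ, 0 < C ∧ ∀ t : ℝ,
    ‖Complex.Gamma ((m : ℂ) + 1 + t * I)‖ ≤
      C * (1 + |t|) ^ (m + 1) * Real.exp (-(Real.pi / 2 * |t|)) := by
  induction m with
  | zero =>
    refine ⟨7, by norm_num, fun t => ?_⟩
    simpa using norm_Gamma_one_add_mul_I_le t
  | succ m ih =>
    obtain ⟨C, hC, h⟩ := ih
    refine ⟨(m + 1) * C, by positivity, fun t => ?_⟩
    rw [Gamma_natCast_add_one_add_mul_I, norm_mul]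
    have h1 : ‖((m + 1 : ℕ) : ℂ) + t * I‖ ≤ (m + 1) * (1 + |t|) := by
      refine (norm_add_le _ _).trans ?_
      simp only [Complex.norm_natCast, norm_mul, Complex.norm_real, Complex.norm_I, mul_one,
        Real.norm_eq_abs]
      push_cast
      nlinarith [abs_nonneg t, (Nat.cast_nonneg m : (0:ℝ) ≤ m), mul_nonneg (Nat.cast_nonneg m : (0:ℝ) ≤ m) (abs_nonneg t)]
    calc _ ≤ ((m + 1) * (1 + |t|)) *
          (C * (1 + |t|) ^ (m + 1) * Real.exp (-(Real.pi / 2 * |t|))) := by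
          gcongr
          exact h t
      _ = _ := by ring

lemma le_norm_Gamma_natCast (m : ℕ) : ∃ c : ℝ, 0 < c ∧ ∀ t : ℝ,
    c * (1 + |t|) ^ m * Real.exp (-(Real.pi / 2 * |t|)) ≤
      ‖Complex.Gamma ((m : ℂ) + 1 + t * I)‖ := by
  induction m with
  | zero =>
    refine ⟨1, by norm_num, fun t => ?_⟩
    simpa using exp_neg_le_norm_Gamma_one_add_mul_I t
  | succ m ih =>
    obtain ⟨c, hc, h⟩ := ih
    refine ⟨c / 2, by positivity, fun t => ?_⟩
    rw [Gamma_natCast_add_one_add_mul_I, norm_mul]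
    have h1 : (1 + |t|) / 2 ≤ ‖((m + 1 : ℕ) : ℂ) + t * I‖ := by
      have hre := Complex.abs_re_le_norm (((m + 1 : ℕ) : ℂ) + t * I)
      have him := Complex.abs_im_le_norm (((m + 1 : ℕ) : ℂ) + t * I)
      simp at hre him
      have : (1:ℝ) ≤ |(m:ℝ) + 1| := by
        rw [abs_of_nonneg (by positivity)]
        linarith [(Nat.cast_nonneg m : (0:ℝ) ≤ m)]
      push_cast
      linarith
    calc _ = ((1 + |t|) / 2) *
          (c * (1 + |t|) ^ m * Real.exp (-(Real.pi / 2 * |t|))) := by ring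
      _ ≤ _ := by
          gcongr
          exact h t

/-- Upper bound for `Γ` on a vertical strip, in terms of an approximation `y` of `2 Im z`. -/
lemma norm_Gamma_le_of_im_near {ε : ℝ} (hε : 0 < ε) (N : ℕ) (hN : 1 ≤ N) {K : ℝ} (hK : 0 ≤ K) :
    ∃ C : ℝ, 0 < C ∧ ∀ (z : ℂ) (y : ℝ), ε ≤ z.re → z.re ≤ N → |2 * z.im - y| ≤ K →
      ‖Complex.Gamma z‖ ≤ C * (1 + |y|) ^ N * Real.exp (-(Real.pi / 4 * |y|)) := by
  obtain ⟨m, rfl⟩ : ∃ m, N = m + 1 := ⟨N - 1, by omega⟩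
  obtain ⟨C, hC, h⟩ := norm_Gamma_natCast_le m
  obtain ⟨D, hD⟩ : ∃ D : ℝ, ∀ x ∈ Icc ε ((m + 1 : ℕ) : ℝ), Real.Gamma x ≤ D := by
    have hc : ContinuousOn Real.Gamma (Icc ε ((m + 1 : ℕ) : ℝ)) := fun x hx =>
      (Real.differentiableAt_Gamma fun k => by
        have := hx.1
        have : (0:ℝ) ≤ k := Nat.cast_nonneg k
        intro h; linarith).continuousAt.continuousWithinAt
    obtain ⟨D, hD⟩ := isCompact_Icc.bddAbove_image hc
    exact ⟨D, fun x hx => hD ⟨x, hx, rfl⟩⟩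
  have hG : 0 < Real.Gamma ((m + 1 : ℕ) : ℝ) := Real.Gamma_pos_of_pos (by positivity)
  refine ⟨(|D| + 1) / Real.Gamma ((m + 1 : ℕ) : ℝ) * C * (1 + K) ^ (m + 1) *
    Real.exp (Real.pi / 4 * K), by positivity, fun z y hz hzN hy => ?_⟩
  have hz0 : 0 < z.re := hε.trans_le hz
  have h1 := norm_Gamma_mul_Gamma_le (b := ((m + 1 : ℕ) : ℝ) - z.re) hz0 (by linarith)
  have h2 : z + ((((m + 1 : ℕ) : ℝ) - z.re : ℝ) : ℂ) = (m : ℂ) + 1 + z.im * I := by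
    apply Complex.ext <;> simp
  rw [h2, add_sub_cancel] at h1
  have h3 : Real.Gamma z.re ≤ |D| + 1 := (hD _ ⟨hz, hzN⟩).trans (by linarith [le_abs_self D])
  have h4 : 1 + |z.im| ≤ (1 + K) * (1 + |y|) := by
    have : |2 * z.im| ≤ K + |y| := by
      calc |2 * z.im| = |(2 * z.im - y) + y| := by ring_nf
        _ ≤ |2 * z.im - y| + |y| := abs_add_le _ _
        _ ≤ _ := by linarith
    rw [abs_mul, abs_two] at this
    nlinarith [abs_nonneg y, abs_nonneg z.im, mul_nonneg hK (abs_nonneg y)]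
  have h5 : -(Real.pi / 2 * |z.im|) ≤ Real.pi / 4 * K + -(Real.pi / 4 * |y|) := by
    have : |y| ≤ K + 2 * |z.im| := by
      calc |y| = |-(2 * z.im - y) + 2 * z.im| := by ring_nf
        _ ≤ |-(2 * z.im - y)| + |2 * z.im| := abs_add_le _ _
        _ ≤ _ := by rw [abs_neg, abs_mul, abs_two]; linarith
    nlinarith [Real.pi_pos]
  rw [← le_div_iff₀ hG] at h1
  calc ‖Complex.Gamma z‖ ≤ _ := h1
    _ ≤ (|D| + 1) * (C * ((1 + K) * (1 + |y|)) ^ (m + 1) *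
          Real.exp (Real.pi / 4 * K + -(Real.pi / 4 * |y|))) / Real.Gamma ((m + 1 : ℕ) : ℝ) := by
        gcongr
        refine (h _).trans ?_
        gcongr
    _ = _ := by rw [Real.exp_add, mul_pow]; ring

/-- Upper bound for `1 / Γ` on a vertical strip, in terms of an approximation `y` of `2 Im z`. -/
lemma norm_inv_Gamma_le_of_im_near (m M : ℕ) {K : ℝ} (hK : 0 ≤ K) :
    ∃ C : ℝ, 0 < C ∧ ∀ (z : ℂ) (y : ℝ), 0 < z.re → m ≤ z.re → z.re ≤ M → |2 * z.im - y| ≤ K →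
      ‖(Complex.Gamma z)⁻¹‖ ≤
        C * ((1 + |y|) * ((1 + |y|) ^ m)⁻¹) * Real.exp (Real.pi / 4 * |y|) := by
  obtain ⟨c, hc, h⟩ := le_norm_Gamma_natCast m
  obtain ⟨d, hd0, hd⟩ : ∃ d : ℝ, 0 < d ∧ ∀ x ∈ Icc (1:ℝ) (M + 1), d ≤ Real.Gamma x := by
    have hc : ContinuousOn Real.Gamma (Icc (1:ℝ) (M + 1)) := fun x hx =>
      (Real.differentiableAt_Gamma fun k => by
        have := hx.1
        have : (0:ℝ) ≤ k := Nat.cast_nonneg k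
        intro h; linarith).continuousAt.continuousWithinAt
    obtain ⟨x, hx, hmin⟩ := isCompact_Icc.exists_isMinOn (nonempty_Icc.mpr (by simp)) hc
    exact ⟨Real.Gamma x, Real.Gamma_pos_of_pos (by linarith [hx.1]), fun y hy => hmin hy⟩
  have hG : 0 < Real.Gamma (m + 1 : ℝ) := Real.Gamma_pos_of_pos (by positivity)
  refine ⟨(M + 1) * (1 + K) * Real.Gamma (m + 1 : ℝ) * (2 * (1 + K)) ^ m / (d * c) *
    Real.exp (Real.pi / 4 * K), by positivity, fun z y hz hzm hzM hy => ?_⟩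
  have hzne : z ≠ 0 := fun h => by simp [h] at hz
  have h1 := norm_Gamma_mul_Gamma_le (z := (m : ℂ) + 1 + z.im * I) (b := z.re - m)
    (by simp; positivity) (by linarith)
  have h2 : (m : ℂ) + 1 + z.im * I + ((z.re - m : ℝ) : ℂ) = z + 1 := by
    apply Complex.ext <;> simp; ring
  have h2' : ((m : ℂ) + 1 + z.im * I).re = m + 1 := by simp
  have h2'' : (m + 1 + (z.re - m) : ℝ) = z.re + 1 := by ring
  rw [h2, h2', h2'', Complex.Gamma_add_one _ hzne, norm_mul] at h1
  have hyz : |y| ≤ K + 2 * |z.im| := by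
    calc |y| = |-(2 * z.im - y) + 2 * z.im| := by ring_nf
      _ ≤ |-(2 * z.im - y)| + |2 * z.im| := abs_add_le _ _
      _ ≤ _ := by rw [abs_neg, abs_mul, abs_two]; linarith
  have hzy : 2 * |z.im| ≤ K + |y| := by
    calc 2 * |z.im| = |(2 * z.im - y) + y| := by rw [sub_add_cancel, abs_mul, abs_two]
      _ ≤ |2 * z.im - y| + |y| := abs_add_le _ _
      _ ≤ _ := by linarith
  have h3 : (1 + |y|) ≤ (2 * (1 + K)) * (1 + |z.im|) := by
    nlinarith [abs_nonneg z.im, mul_nonneg hK (abs_nonneg z.im)]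
  have h4 : ‖z‖ ≤ (M + 1) * (1 + K) * (1 + |y|) := by
    have hM : (0:ℝ) ≤ M := Nat.cast_nonneg M
    have a1 : ‖z‖ ≤ M + (K + |y|) := by
      refine (Complex.norm_le_abs_re_add_abs_im z).trans ?_
      rw [abs_of_pos hz]
      linarith [abs_nonneg z.im]
    have a2 : 1 + K + |y| ≤ (1 + K) * (1 + |y|) := by nlinarith [mul_nonneg hK (abs_nonneg y)]
    have a3 : 1 ≤ (1 + K) * (1 + |y|) := by nlinarith [mul_nonneg hK (abs_nonneg y), abs_nonneg y]
    nlinarith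
  have h5 : Real.exp (Real.pi / 2 * |z.im|) ≤
      Real.exp (Real.pi / 4 * K) * Real.exp (Real.pi / 4 * |y|) := by
    rw [← Real.exp_add]
    refine Real.exp_le_exp.mpr ?_
    nlinarith [Real.pi_pos]
  have hGz : 0 < ‖Complex.Gamma z‖ := norm_pos_iff.mpr (Complex.Gamma_ne_zero_of_re_pos hz)
  have h6 : c * (1 + |z.im|) ^ m * Real.exp (-(Real.pi / 2 * |z.im|)) * d ≤
      Real.Gamma (m + 1) * (‖z‖ * ‖Complex.Gamma z‖) := by
    refine le_trans ?_ h1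
    gcongr
    · exact h _
    · exact hd _ ⟨by linarith, by linarith⟩
  have h7 : (1 + |y|) ^ m ≤ (2 * (1 + K)) ^ m * (1 + |z.im|) ^ m := by
    rw [← mul_pow]; gcongr
  have h8 : 0 < (1 + |y|) ^ m := by positivity
  rw [norm_inv, inv_le_iff_one_le_mul₀ hGz]
  rw [Real.exp_neg] at h6
  have h9 : c * d * (1 + |z.im|) ^ m ≤ Real.Gamma (m + 1) * (‖z‖ * ‖Complex.Gamma z‖) *
      Real.exp (Real.pi / 2 * |z.im|) := by
    have := Real.exp_pos (Real.pi / 2 * |z.im|)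
    calc _ = c * (1 + |z.im|) ^ m * (Real.exp (Real.pi / 2 * |z.im|))⁻¹ * d *
          Real.exp (Real.pi / 2 * |z.im|) := by field_simp
      _ ≤ _ := by gcongr
  have h10 : c * d * (1 + |y|) ^ m ≤ (2 * (1 + K)) ^ m * (Real.Gamma (m + 1) *
      (((M + 1) * (1 + K) * (1 + |y|)) * ‖Complex.Gamma z‖) *
      (Real.exp (Real.pi / 4 * K) * Real.exp (Real.pi / 4 * |y|))) := by
    calc _ ≤ c * d * ((2 * (1 + K)) ^ m * (1 + |z.im|) ^ m) := by gcongr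
      _ = (2 * (1 + K)) ^ m * (c * d * (1 + |z.im|) ^ m) := by ring
      _ ≤ _ := mul_le_mul_of_nonneg_left (h9.trans (by gcongr)) (by positivity)
  calc (1:ℝ) = (c * d * (1 + |y|) ^ m) / (c * d * (1 + |y|) ^ m) := by
        rw [div_self (by positivity)]
    _ ≤ _ := div_le_div_of_nonneg_right h10 (by positivity)
    _ = _ := by field_simp

/-! ### Shifting vertical contours -/

lemma integrable_exp_neg_mul_abs {c : ℝ} (hc : 0 < c) :
    Integrable fun t : ℝ => Real.exp (-(c * |t|)) := by
  have h1 : IntegrableOn (fun t : ℝ => Real.exp (-(c * |t|))) (Ioi 0) := by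
    refine (exp_neg_integrableOn_Ioi 0 hc).congr_fun (fun t ht => ?_) measurableSet_Ioi
    simp only [abs_of_pos (mem_Ioi.mp ht), neg_mul]
  have h2 : IntegrableOn (fun t : ℝ => Real.exp (-(c * |t|))) (Iic 0) := by
    rw [← integrableOn_Ici_iff_integrableOn_Ioi] at h1
    have := h1.comp_neg
    simpa using this
  rw [← integrableOn_univ, ← Iic_union_Ioi (a := (0:ℝ))]
  exact h2.union h1

lemma integrable_vertical_line {f : ℂ → ℂ} {a C c : ℝ} (hc : 0 < c)
    (hf : ∀ z : ℂ, z.re = a → ContinuousAt f z)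
    (hbd : ∀ z : ℂ, z.re = a → ‖f z‖ ≤ C * Real.exp (-(c * |z.im|))) :
    Integrable fun t : ℝ => f (a + t * I) := by
  refine ((integrable_exp_neg_mul_abs hc).const_mul C).mono' ?_ ?_
  · refine Continuous.aestronglyMeasurable (continuous_iff_continuousAt.mpr fun t => ?_)
    exact ContinuousAt.comp (f := fun t : ℝ => (a + t * I : ℂ)) (hf _ (by simp)) (by fun_prop)
  · refine Filter.Eventually.of_forall fun t => ?_
    simpa using hbd (a + t * I) (by simp)

lemma integral_vertical_line_eq {f : ℂ → ℂ} {a b C c : ℝ} (hab : a ≤ b) (hc : 0 < c)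
    (hf : ∀ z : ℂ, a ≤ z.re → z.re ≤ b → DifferentiableAt ℂ f z)
    (hbd : ∀ z : ℂ, a ≤ z.re → z.re ≤ b → ‖f z‖ ≤ C * Real.exp (-(c * |z.im|))) :
    ∫ t : ℝ, f (a + t * I) = ∫ t : ℝ, f (b + t * I) := by
  have hia : Integrable fun t : ℝ => f (a + t * I) := integrable_vertical_line hc
    (fun z hz => (hf z hz.ge (hz.le.trans hab)).continuousAt)
    (fun z hz => hbd z hz.ge (hz.le.trans hab))
  have hib : Integrable fun t : ℝ => f (b + t * I) := integrable_vertical_line hc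
    (fun z hz => (hf z (hab.trans hz.ge) hz.le).continuousAt)
    (fun z hz => hbd z (hab.trans hz.ge) hz.le)
  have hla := intervalIntegral_tendsto_integral hia Filter.tendsto_neg_atTop_atBot Filter.tendsto_id
  have hlb := intervalIntegral_tendsto_integral hib Filter.tendsto_neg_atTop_atBot Filter.tendsto_id
  have hexp : Filter.Tendsto (fun R : ℝ => C * Real.exp (-(c * |R|)) * |b - a|) Filter.atTop
      (nhds 0) := by
    have h1 : Filter.Tendsto (fun R : ℝ => c * |R|) Filter.atTop Filter.atTop :=
      Filter.tendsto_abs_atTop_atTop.const_mul_atTop hc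
    have h2 := Real.tendsto_exp_neg_atTop_nhds_zero.comp h1
    simpa using (h2.const_mul C).mul_const |b - a|
  have hhor : ∀ e : ℝ, |e| = 1 → Filter.Tendsto
      (fun R : ℝ => ∫ x in a..b, f (x + ((e * R : ℝ) : ℂ) * I)) Filter.atTop (nhds 0) := by
    intro e he
    refine squeeze_zero_norm (fun R => ?_) hexp
    refine intervalIntegral.norm_integral_le_of_norm_le_const fun x hx => ?_
    rw [uIoc_of_le hab] at hx
    have := hbd (x + ((e * R : ℝ) : ℂ) * I) (by simpa using hx.1.le) (by simpa using hx.2)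
    simpa [abs_mul, he] using this
  have hrect : ∀ R : ℝ, (∫ x in a..b, f (x + (((-1) * R : ℝ) : ℂ) * I)) -
      (∫ x in a..b, f (x + ((1 * R : ℝ) : ℂ) * I)) +
      I * (∫ y in (-R)..R, f (b + y * I)) - I * (∫ y in (-R)..R, f (a + y * I)) = 0 := by
    intro R
    have := Complex.integral_boundary_rect_eq_zero_of_differentiableOn f (a + (-R : ℝ) * I)
      (b + R * I) (fun z hz => by
        rw [Complex.mem_reProdIm] at hz
        have h1 := hz.1
        simp [uIcc_of_le hab] at h1
        exact (hf z h1.1 h1.2).differentiableWithinAt)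
    simpa using this
  have hlim := (((hhor (-1) (by simp)).sub (hhor 1 (by simp))).add (hlb.const_mul I)).sub
    (hla.const_mul I)
  have h0 := tendsto_nhds_unique hlim ((tendsto_const_nhds (x := (0:ℂ))).congr
    fun R => (hrect R).symm)
  have h1 : I * ((∫ t : ℝ, f (b + t * I)) - ∫ t : ℝ, f (a + t * I)) = 0 := by
    rw [← h0]; ring
  rcases mul_eq_zero.mp h1 with h | h
  · exact absurd h Complex.I_ne_zero
  · exact (sub_eq_zero.mp h).symm

/-! ### The inverse Kontorovich–Lebedev transform near the origin -/

/-- The spectral density `H(μ) μ sin(πμ)`. -/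
noncomputable def spectralDensity (H : ℂ → ℂ) (μ : ℂ) : ℂ := H μ * (μ * Complex.sin (Real.pi * μ))

/-- The Fourier transform of the spectral density along the imaginary axis. -/
noncomputable def spectralFourier (H : ℂ → ℂ) (r : ℝ) : ℂ :=
  ∫ t : ℝ, spectralDensity H (t * I) * Complex.exp (t * I * r)

lemma norm_sin_le (z : ℂ) : ‖Complex.sin z‖ ≤ Real.exp |z.im| := by
  have h1 : ‖Complex.exp (-z * I)‖ ≤ Real.exp |z.im| := by
    rw [Complex.norm_exp]; simpa using le_abs_self z.im
  have h2 : ‖Complex.exp (z * I)‖ ≤ Real.exp |z.im| := by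
    rw [Complex.norm_exp]; simpa using neg_le_abs z.im
  rw [Complex.sin, norm_div, norm_mul, Complex.norm_I]
  have := norm_sub_le (Complex.exp (-z * I)) (Complex.exp (z * I))
  simp only [Complex.norm_ofNat, mul_one]
  linarith

section spectral

variable {η L : ℝ} {H : ℂ → ℂ}

lemma spectralDensity_differentiableAt (hH : MemCeta η H) {z : ℂ} (hz : |z.re| < 2 * η) :
    DifferentiableAt ℂ (spectralDensity H) z := by
  have hopen : IsOpen {μ : ℂ | |μ.re| < 2 * η} :=
    isOpen_lt (by fun_prop) continuous_const
  have h1 : DifferentiableAt ℂ H z := hH.1.differentiableAt (hopen.mem_nhds hz)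
  unfold spectralDensity
  fun_prop

lemma norm_spectralDensity_le (hH : MemCeta η H) (hL : L < 2 * η) : ∃ C : ℝ, 0 < C ∧ ∀ z : ℂ,
    |z.re| ≤ L → ‖spectralDensity H z‖ ≤ C * Real.exp (-|z.im|) := by
  obtain ⟨C, hC⟩ := hH.2.2
  refine ⟨(|C| + 1) * (|L| + 1), by positivity, fun z hz => ?_⟩
  have h1 := hC z (hz.trans_lt hL)
  have h2 : ‖z‖ ≤ (|L| + 1) * Real.exp |z.im| := by
    refine (Complex.norm_le_abs_re_add_abs_im z).trans ?_
    have h3 : |z.re| ≤ |L| := hz.trans (le_abs_self L)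
    have h4 : |z.im| + 1 ≤ Real.exp |z.im| := Real.add_one_le_exp _
    nlinarith [abs_nonneg L, abs_nonneg z.im]
  have h3 := norm_sin_le (Real.pi * z)
  rw [Complex.im_ofReal_mul, abs_mul, abs_of_pos Real.pi_pos] at h3
  rw [spectralDensity, norm_mul, norm_mul]
  calc _ ≤ ((|C| + 1) * Real.exp (-2 * Real.pi * |z.im|)) *
        (((|L| + 1) * Real.exp |z.im|) * Real.exp (Real.pi * |z.im|)) := by
        gcongr
        refine h1.trans ?_
        gcongr
        linarith [le_abs_self C]
    _ = (|C| + 1) * (|L| + 1) *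
        Real.exp (-2 * Real.pi * |z.im| + |z.im| + Real.pi * |z.im|) := by
        rw [Real.exp_add, Real.exp_add]; ring
    _ ≤ _ := by
        gcongr
        nlinarith [Real.two_le_pi, abs_nonneg z.im]

lemma norm_exp_mul_ofReal_le {z : ℂ} (hz : |z.re| ≤ L) (r : ℝ) :
    ‖Complex.exp (z * r)‖ ≤ Real.exp (L * |r|) := by
  rw [Complex.norm_exp, Complex.re_mul_ofReal]
  refine Real.exp_le_exp.mpr ((le_abs_self _).trans ?_)
  rw [abs_mul]
  gcongr

lemma spectralFourier_eq (hH : MemCeta η H) (hL : L < 2 * η) {a : ℝ} (ha : |a| ≤ L) (r : ℝ) :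
    spectralFourier H r =
      ∫ t : ℝ, spectralDensity H (a + t * I) * Complex.exp ((a + t * I) * r) := by
  obtain ⟨C, hC0, hC⟩ := norm_spectralDensity_le hH hL
  have hL0 : 0 ≤ L := (abs_nonneg a).trans ha
  have hd : ∀ z : ℂ, |z.re| ≤ L →
      DifferentiableAt ℂ (fun z => spectralDensity H z * Complex.exp (z * r)) z := fun z hz =>
    (spectralDensity_differentiableAt hH (hz.trans_lt hL)).mul (by fun_prop)
  have hb : ∀ z : ℂ, |z.re| ≤ L → ‖spectralDensity H z * Complex.exp (z * r)‖ ≤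
      C * Real.exp (L * |r|) * Real.exp (-(1 * |z.im|)) := by
    intro z hz
    rw [norm_mul]
    calc _ ≤ (C * Real.exp (-|z.im|)) * Real.exp (L * |r|) := by
          gcongr
          · exact hC z hz
          · exact norm_exp_mul_ofReal_le hz r
      _ = _ := by ring_nf
  rw [abs_le] at ha
  have h0 : spectralFourier H r =
      ∫ t : ℝ, spectralDensity H ((0:ℝ) + t * I) * Complex.exp (((0:ℝ) + t * I) * r) := by
    simp [spectralFourier]
  rw [h0]
  rcases le_total 0 a with h | h
  · exact integral_vertical_line_eq h one_pos
      (fun z h1 h2 => hd z (abs_le.mpr ⟨by linarith, by linarith⟩))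
      (fun z h1 h2 => hb z (abs_le.mpr ⟨by linarith, by linarith⟩))
  · exact (integral_vertical_line_eq h one_pos
      (fun z h1 h2 => hd z (abs_le.mpr ⟨by linarith, by linarith⟩))
      (fun z h1 h2 => hb z (abs_le.mpr ⟨by linarith, by linarith⟩))).symm

lemma integrable_spectralDensity (hH : MemCeta η H) {a : ℝ} (ha : |a| < 2 * η) :
    Integrable fun t : ℝ => spectralDensity H (a + t * I) := by
  obtain ⟨C, hC0, hC⟩ := norm_spectralDensity_le hH ha
  refine integrable_vertical_line (C := C) one_pos
    (fun z hz => (spectralDensity_differentiableAt hH (by rwa [hz])).continuousAt)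
    (fun z hz => ?_)
  simpa using hC z (by rw [hz])

lemma norm_spectralFourier_le (hH : MemCeta η H) (hL0 : 0 ≤ L) (hL : L < 2 * η) :
    ∃ C : ℝ, 0 < C ∧ ∀ r : ℝ, ‖spectralFourier H r‖ ≤ C * Real.exp (-(L * |r|)) := by
  obtain ⟨C, hC0, hC⟩ := norm_spectralDensity_le hH hL
  have hint := (integrable_exp_neg_mul_abs one_pos).const_mul C
  have key : ∀ a r : ℝ, |a| = L → a * r = -(L * |r|) → ‖spectralFourier H r‖ ≤
      (∫ t : ℝ, C * Real.exp (-(1 * |t|))) * Real.exp (-(L * |r|)) := by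
    intro a r ha har
    rw [spectralFourier_eq hH hL ha.le r, ← integral_mul_const]
    refine norm_integral_le_of_norm_le (hint.mul_const _) (Filter.Eventually.of_forall fun t => ?_)
    rw [norm_mul, Complex.norm_exp]
    have h1 := hC (a + t * I) (by simp [ha])
    have h2 : ((a + t * I) * (r : ℂ)).re = -(L * |r|) := by simp [har]
    rw [h2]
    gcongr
    simpa using h1
  refine ⟨(∫ t : ℝ, C * Real.exp (-(1 * |t|))) + 1,
    add_pos_of_nonneg_of_pos (integral_nonneg fun t => by positivity) one_pos, fun r => ?_⟩
  have h : ‖spectralFourier H r‖ ≤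
      (∫ t : ℝ, C * Real.exp (-(1 * |t|))) * Real.exp (-(L * |r|)) := by
    rcases le_total 0 r with hr | hr
    · exact key (-L) r (by rw [abs_neg, abs_of_nonneg hL0]) (by rw [abs_of_nonneg hr]; ring)
    · exact key L r (abs_of_nonneg hL0) (by rw [abs_of_nonpos hr]; ring)
  refine h.trans ?_
  gcongr
  linarith

lemma continuous_spectralFourier (hH : MemCeta η H) (hη : 0 < η) :
    Continuous (spectralFourier H) := by
  have hint := integrable_spectralDensity hH (a := 0) (by simpa using hη)
  simp only [Complex.ofReal_zero, zero_add] at hint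
  refine continuous_of_dominated (bound := fun t => ‖spectralDensity H (t * I)‖) ?_ ?_ hint.norm ?_
  · intro r
    exact hint.1.mul (Continuous.aestronglyMeasurable (by fun_prop))
  · intro r
    refine Filter.Eventually.of_forall fun t => ?_
    rw [norm_mul, Complex.norm_exp]
    simp
  · exact Filter.Eventually.of_forall fun t => by fun_prop

lemma integrable_spectralFourier_mul (hH : MemCeta η H) (hL0 : 0 ≤ L) (hL : L < 2 * η)
    {φ : ℝ → ℂ} (hφ : Continuous φ) {A M : ℝ} (hM : M < L)
    (hbd : ∀ r, ‖φ r‖ ≤ A * Real.exp (M * |r|)) :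
    Integrable fun r : ℝ => spectralFourier H r * φ r := by
  obtain ⟨C, hC0, hC⟩ := norm_spectralFourier_le hH hL0 hL
  refine ((integrable_exp_neg_mul_abs (sub_pos.mpr hM)).const_mul (C * A)).mono' ?_ ?_
  · exact ((continuous_spectralFourier hH (by linarith)).mul hφ).aestronglyMeasurable
  · refine Filter.Eventually.of_forall fun r => ?_
    rw [norm_mul]
    calc _ ≤ (C * Real.exp (-(L * |r|))) * (A * Real.exp (M * |r|)) := by
          gcongr
          · exact hC r
          · exact hbd r
      _ = C * A * (Real.exp (-(L * |r|)) * Real.exp (M * |r|)) := by ring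
      _ = _ := by rw [← Real.exp_add]; ring_nf

lemma integral_spectralFourier_mul_exp (hH : MemCeta η H) (m : ℤ) (hm : (|m| : ℤ) + 1 < 2 * η) :
    ∫ r : ℝ, spectralFourier H r * Complex.exp (m * r) = 0 := by
  have hm' : |(m : ℝ)| + 1 < 2 * η := by exact_mod_cast hm
  have habs : |(-m : ℝ)| = |(m : ℝ)| := abs_neg _
  set F : ℝ → ℂ := fun t => spectralDensity H (((-m : ℝ) : ℂ) + t * I) with hF
  have hFint : Integrable F := integrable_spectralDensity hH (by linarith)
  have hFcont : Continuous F := by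
    refine continuous_iff_continuousAt.mpr fun t => ?_
    have h : ContinuousAt (spectralDensity H) (((-m : ℝ) : ℂ) + t * I) :=
      (spectralDensity_differentiableAt hH (by simp; linarith)).continuousAt
    exact h.comp (f := fun t : ℝ => (((-m : ℝ) : ℂ) + t * I)) (by fun_prop)
  have hg : ∀ r : ℝ, spectralFourier H r * Complex.exp (m * r) =
      ∫ t : ℝ, F t * Complex.exp (t * I * r) := by
    intro r
    rw [spectralFourier_eq hH (L := |(m : ℝ)|) (by linarith) (a := -m) habs.le r,
      ← integral_mul_const]
    refine integral_congr_ae (Filter.Eventually.of_forall fun t => ?_)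
    simp only [hF]
    rw [mul_assoc, ← Complex.exp_add]
    congr 2
    push_cast
    ring
  have hinv : ∀ x : ℝ, FourierTransformInv.fourierInv F x =
      spectralFourier H (2 * Real.pi * x) * Complex.exp (m * (2 * Real.pi * x : ℝ)) := by
    intro x
    rw [hg, Real.fourierInv_eq']
    refine integral_congr_ae (Filter.Eventually.of_forall fun t => ?_)
    simp only [smul_eq_mul]
    rw [mul_comm]
    congr 2
    simp
    ring
  have hint : Integrable fun r : ℝ => spectralFourier H r * Complex.exp (m * r) :=
    integrable_spectralFourier_mul hH (L := |(m : ℝ)| + 1) (by positivity) hm' (by fun_prop)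
      (A := 1) (M := |(m : ℝ)|) (by linarith) (fun r => by
        have := norm_exp_mul_ofReal_le (L := |(m : ℝ)|) (z := (m : ℂ)) (by simp) r
        simpa using this)
  have hpi : (2 * Real.pi) ≠ 0 := by positivity
  have hinvint : Integrable (FourierTransformInv.fourierInv F) := by
    rw [funext hinv]
    exact hint.comp_mul_left' hpi
  have hfourint : Integrable (FourierTransform.fourier F) := by
    have h : FourierTransform.fourier F = fun x => FourierTransformInv.fourierInv F (-x) := by
      funext x
      rw [Real.fourierInv_eq_fourier_neg, neg_neg]
    rw [h]
    exact hinvint.comp_neg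
  have h1 := congrFun (hFcont.fourier_fourierInv_eq hFint hfourint) 0
  rw [Real.fourier_eq'] at h1
  have h2 : F 0 = 0 := by
    have hs : Complex.sin (Real.pi * m) = 0 := by
      rw [mul_comm]; exact Complex.sin_int_mul_pi m
    simp [hF, spectralDensity, hs]
  have h3 : ∫ x : ℝ, FourierTransformInv.fourierInv F x = 0 := by
    rw [← h2, ← h1]
    refine integral_congr_ae (Filter.Eventually.of_forall fun t => ?_)
    simp
  rw [funext hinv] at h3
  have h4 := Measure.integral_comp_mul_left
    (fun r : ℝ => spectralFourier H r * Complex.exp (m * r)) (2 * Real.pi)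
  rw [h3] at h4
  have h5 : |(2 * Real.pi)⁻¹| ≠ 0 := by positivity
  exact (smul_eq_zero.mp h4.symm).resolve_left h5

end spectral

section flat

variable {η : ℝ} {H : ℂ → ℂ}

lemma cosh_le_exp_abs (r : ℝ) : Real.cosh r ≤ Real.exp |r| := by
  rw [Real.cosh_eq]
  have h1 : Real.exp r ≤ Real.exp |r| := Real.exp_le_exp.mpr (le_abs_self r)
  have h2 : Real.exp (-r) ≤ Real.exp |r| := Real.exp_le_exp.mpr (neg_le_abs r)
  linarith

lemma norm_cosh_pow_mul_exp_le (j : ℕ) (m : ℤ) (r : ℝ) :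
    ‖(Real.cosh r : ℂ) ^ j * Complex.exp (m * r)‖ ≤ 1 * Real.exp ((j + |(m : ℝ)|) * |r|) := by
  rw [norm_mul, norm_pow, Complex.norm_real, Real.norm_of_nonneg (Real.cosh_pos r).le, one_mul]
  have h1 := norm_exp_mul_ofReal_le (L := |(m : ℝ)|) (z := (m : ℂ)) (by simp) r
  calc _ ≤ (Real.exp |r|) ^ j * Real.exp (|(m : ℝ)| * |r|) := by
        have := (Real.cosh_pos r).le
        gcongr
        exact cosh_le_exp_abs r
    _ = _ := by rw [← Real.exp_nat_mul, ← Real.exp_add]; ring_nf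

lemma integral_spectralFourier_mul_cosh_pow (hH : MemCeta η H) (j : ℕ) :
    ∀ m : ℤ, (j : ℝ) + |(m : ℝ)| + 1 < 2 * η →
      ∫ r : ℝ, spectralFourier H r * ((Real.cosh r : ℂ) ^ j * Complex.exp (m * r)) = 0 := by
  have hint : ∀ (i : ℕ) (m : ℤ), (i : ℝ) + |(m : ℝ)| + 1 < 2 * η → Integrable fun r : ℝ =>
      spectralFourier H r * ((Real.cosh r : ℂ) ^ i * Complex.exp (m * r)) := fun i m h =>
    integrable_spectralFourier_mul hH (L := (i : ℝ) + |(m : ℝ)| + 1) (by positivity) h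
      (by fun_prop) (by linarith) (norm_cosh_pow_mul_exp_le i m)
  induction j with
  | zero =>
    intro m hm
    simpa using integral_spectralFourier_mul_exp hH m (by push_cast at hm ⊢; linarith)
  | succ j ih =>
    intro m hm
    have hm1 : (j : ℝ) + |((m + 1 : ℤ) : ℝ)| + 1 < 2 * η := by
      push_cast at hm ⊢
      have := abs_add_le (m : ℝ) 1
      rw [abs_one] at this
      linarith
    have hm2 : (j : ℝ) + |((m - 1 : ℤ) : ℝ)| + 1 < 2 * η := by
      push_cast at hm ⊢
      have := abs_sub (m : ℝ) 1
      rw [abs_one] at this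
      linarith
    have h : ∀ r : ℝ,
        spectralFourier H r * ((Real.cosh r : ℂ) ^ (j + 1) * Complex.exp (m * r)) =
        (1 / 2 : ℂ) * (spectralFourier H r *
            ((Real.cosh r : ℂ) ^ j * Complex.exp ((m + 1 : ℤ) * r)) +
          spectralFourier H r * ((Real.cosh r : ℂ) ^ j * Complex.exp ((m - 1 : ℤ) * r))) := by
      intro r
      have h1 : Complex.exp ((m + 1 : ℤ) * r) = Complex.exp (m * r) * Complex.exp r := by
        rw [← Complex.exp_add]; push_cast; ring_nf
      have h2 : Complex.exp ((m - 1 : ℤ) * r) = Complex.exp (m * r) * Complex.exp (-r) := by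
        rw [← Complex.exp_add]; push_cast; ring_nf
      have h3 : (Real.cosh r : ℂ) = (Complex.exp r + Complex.exp (-r)) / 2 := by
        rw [Complex.ofReal_cosh]; rfl
      rw [h1, h2, pow_succ]
      nth_rewrite 2 [h3]
      ring
    rw [integral_congr_ae (Filter.Eventually.of_forall h), integral_const_mul,
      integral_add (hint j _ hm1) (hint j _ hm2), ih _ hm1, ih _ hm2]
    simp

lemma abs_exp_neg_sub_sum_le (k : ℕ) {X : ℝ} (hX : 0 ≤ X) :
    |Real.exp (-X) - ∑ j ∈ Finset.range k, (-X) ^ j / (j.factorial : ℝ)| ≤ (k + 2) * X ^ k := by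
  rcases Nat.eq_zero_or_pos k with rfl | hk
  · have : Real.exp (-X) ≤ 1 := Real.exp_le_one_iff.mpr (by linarith)
    simp only [Finset.range_zero, Finset.sum_empty, sub_zero, abs_of_pos (Real.exp_pos _)]
    norm_num
    linarith
  rcases le_total X 1 with h | h
  · have h1 := Real.exp_bound (x := -X) (by rwa [abs_neg, abs_of_nonneg hX]) hk
    rw [abs_neg, abs_of_nonneg hX] at h1
    refine h1.trans ?_
    rw [mul_comm]
    gcongr
    have h2 : (1:ℝ) ≤ k := by exact_mod_cast hk
    have h3 : (1:ℝ) ≤ k.factorial := by exact_mod_cast Nat.one_le_iff_ne_zero.mpr k.factorial_ne_zero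
    rw [div_le_iff₀ (by positivity)]
    push_cast
    nlinarith [mul_le_mul h3 h2 zero_le_one (by positivity)]
  · have h1 : |∑ j ∈ Finset.range k, (-X) ^ j / (j.factorial : ℝ)| ≤ k * X ^ k := by
      refine (Finset.abs_sum_le_sum_abs _ _).trans ?_
      refine (Finset.sum_le_card_nsmul _ _ (X ^ k) fun j hj => ?_).trans (by simp)
      rw [abs_div, abs_pow, abs_neg, abs_of_nonneg hX, Nat.abs_cast]
      have h3 : (1:ℝ) ≤ j.factorial := by
        exact_mod_cast Nat.one_le_iff_ne_zero.mpr j.factorial_ne_zero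
      refine (div_le_self (by positivity) h3).trans ?_
      exact pow_le_pow_right₀ h (Finset.mem_range.mp hj).le
    have h2 : |Real.exp (-X)| ≤ X ^ k := by
      rw [abs_of_pos (Real.exp_pos _)]
      exact (Real.exp_le_one_iff.mpr (by linarith)).trans (one_le_pow₀ h)
    have h3 : 0 ≤ X ^ k := by positivity
    refine (abs_sub _ _).trans ?_
    linarith

lemma abs_le_cosh (r : ℝ) : |r| ≤ Real.cosh r := by
  rw [← Real.cosh_abs, Real.cosh_eq]
  have h1 := Real.quadratic_le_exp_of_nonneg (abs_nonneg r)
  nlinarith [Real.exp_pos (-|r|), sq_nonneg (|r| - 1)]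

lemma integrable_exp_neg_mul_cosh {x : ℝ} (hx : 0 < x) :
    Integrable fun r : ℝ => Real.exp (-(x * Real.cosh r)) := by
  refine (integrable_exp_neg_mul_abs hx).mono'
    (Continuous.aestronglyMeasurable (by fun_prop)) (Filter.Eventually.of_forall fun r => ?_)
  rw [Real.norm_of_nonneg (Real.exp_pos _).le]
  gcongr
  exact abs_le_cosh r

lemma KBessel_mul_I (t : ℝ) {x : ℝ} (hx : 0 < x) : KBessel (t * I) x =
    (1 / 2 : ℂ) * ∫ r : ℝ, (Real.exp (-(x * Real.cosh r)) : ℂ) * Complex.exp (t * I * r) := by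
  set f : ℝ → ℂ := fun r => (Real.exp (-(x * Real.cosh r)) : ℂ) * Complex.exp (t * I * r) with hf
  have hint : Integrable f := by
    refine (integrable_exp_neg_mul_cosh hx).mono'
      (Continuous.aestronglyMeasurable (by fun_prop)) (Filter.Eventually.of_forall fun r => ?_)
    rw [hf, norm_mul, Complex.norm_real, Real.norm_of_nonneg (Real.exp_pos _).le,
      Complex.norm_exp]
    simp
  rw [← intervalIntegral.integral_Iic_add_Ioi (b := 0) hint.integrableOn hint.integrableOn]
  have h1 := integral_comp_neg_Ioi 0 f
  rw [neg_zero] at h1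
  rw [← h1, ← integral_add hint.comp_neg.integrableOn hint.integrableOn, ← integral_const_mul,
    KBessel]
  refine integral_congr_ae (Filter.Eventually.of_forall fun r => ?_)
  simp only [hf, Real.cosh_neg, Complex.cosh]
  push_cast
  ring_nf

lemma inv_Gamma_mul_Gamma_neg (t : ℝ) :
    (Complex.Gamma (t * I) * Complex.Gamma (-(t * I)))⁻¹ =
      -(t * I * Complex.sin (Real.pi * (t * I))) / Real.pi := by
  rcases eq_or_ne t 0 with rfl | ht
  · simp
  have htI : (t : ℂ) * I ≠ 0 := by simp [ht]
  have h1 := Complex.Gamma_mul_Gamma_one_sub (t * I)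
  have h2 : (1 : ℂ) - t * I = -(t * I) + 1 := by ring
  rw [h2, Complex.Gamma_add_one _ (neg_ne_zero.mpr htI)] at h1
  have hs : Complex.sin (Real.pi * (t * I)) ≠ 0 := by
    rw [← mul_assoc, Complex.sin_mul_I, ← Complex.ofReal_mul, ← Complex.ofReal_sinh]
    refine mul_ne_zero ?_ Complex.I_ne_zero
    exact_mod_cast (Real.sinh_ne_zero.mpr (mul_ne_zero Real.pi_ne_zero ht))
  have hpi : (Real.pi : ℂ) ≠ 0 := by exact_mod_cast Real.pi_ne_zero
  have h3 : Complex.Gamma (t * I) * Complex.Gamma (-(t * I)) =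
      -(Real.pi / (t * I * Complex.sin (Real.pi * (t * I)))) := by
    rw [eq_div_iff hs] at h1
    rw [eq_neg_iff_add_eq_zero, ← sub_neg_eq_add, sub_eq_zero, ← neg_div, eq_div_iff (by simp [*])]
    linear_combination -h1
  rw [h3, inv_neg, inv_div, neg_div]

lemma Hflat_eq (hH : MemCeta η H) (hη : 0 < η) {y : ℝ} (hy : 0 < y) :
    Hflat H y = -(1 / (4 * (Real.pi : ℂ) ^ 2)) * (Real.sqrt y : ℂ) *
      ∫ r : ℝ, spectralFourier H r * (Real.exp (-(2 * Real.pi * y * Real.cosh r)) : ℂ) := by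
  have hx : 0 < 2 * Real.pi * y := by positivity
  set x := 2 * Real.pi * y
  have hpi : (Real.pi : ℂ) ≠ 0 := by exact_mod_cast Real.pi_ne_zero
  have h1 : ∀ t : ℝ, H (t * I) * W2 (t * I) y /
      (Complex.Gamma (t * I) * Complex.Gamma (-(t * I))) = -((Real.sqrt y : ℂ) / Real.pi) *
        ∫ r : ℝ, spectralDensity H (t * I) *
          ((Real.exp (-(x * Real.cosh r)) : ℂ) * Complex.exp (t * I * r)) := by
    intro t
    rw [div_eq_mul_inv, inv_Gamma_mul_Gamma_neg, W2, KBessel_mul_I t hx, integral_const_mul,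
      spectralDensity]
    ring
  have hQ := integrable_spectralDensity hH (a := 0) (by simpa using hη)
  simp only [Complex.ofReal_zero, zero_add] at hQ
  have hprod : Integrable (Function.uncurry fun t r : ℝ => spectralDensity H (t * I) *
      ((Real.exp (-(x * Real.cosh r)) : ℂ) * Complex.exp (t * I * r))) (volume.prod volume) := by
    have hb := hQ.mul_prod ((integrable_exp_neg_mul_cosh hx).ofReal (𝕜 := ℂ))
    refine hb.mono ?_ (Filter.Eventually.of_forall fun p => ?_)
    · have h2 : AEStronglyMeasurable (fun p : ℝ × ℝ => Complex.exp (p.1 * I * p.2))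
          (volume.prod volume) := Continuous.aestronglyMeasurable (by fun_prop)
      refine (hb.1.mul h2).congr (Filter.Eventually.of_forall fun p => ?_)
      simp [Function.uncurry, mul_assoc]
    · simp only [Function.uncurry, norm_mul, Complex.norm_exp (_ * I * _)]
      simp
  rw [Hflat, integral_congr_ae (Filter.Eventually.of_forall h1), integral_const_mul,
    integral_integral_swap hprod]
  have h2 : ∀ r : ℝ, (∫ t : ℝ, spectralDensity H (t * I) *
      ((Real.exp (-(x * Real.cosh r)) : ℂ) * Complex.exp (t * I * r))) =
      spectralFourier H r * (Real.exp (-(x * Real.cosh r)) : ℂ) := by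
    intro r
    rw [spectralFourier, ← integral_mul_const]
    refine integral_congr_ae (Filter.Eventually.of_forall fun t => ?_)
    simp only
    ring
  rw [integral_congr_ae (Filter.Eventually.of_forall h2)]
  field_simp

lemma norm_Hflat_le (hH : MemCeta η H) (k : ℕ) (hk : (k : ℝ) + 1 < 2 * η) :
    ∃ C : ℝ, 0 < C ∧ ∀ y : ℝ, 0 < y → ‖Hflat H y‖ ≤ C * (Real.sqrt y * y ^ k) := by
  have hη : 0 < η := by have := (Nat.cast_nonneg k : (0:ℝ) ≤ k); linarith
  have hL : (0:ℝ) ≤ (k : ℝ) + 1 := by positivity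
  set J : ℝ := ∫ r : ℝ, ‖spectralFourier H r * ((Real.cosh r ^ k : ℝ) : ℂ)‖ with hJ
  have hint : ∀ j : ℕ, j ≤ k →
      Integrable fun r : ℝ => spectralFourier H r * ((Real.cosh r ^ j : ℝ) : ℂ) := by
    intro j hj
    refine integrable_spectralFourier_mul hH hL hk (by fun_prop) (A := 1) (M := k) (by linarith)
      fun r => ?_
    have h := norm_cosh_pow_mul_exp_le j 0 r
    simp only [Int.cast_zero, zero_mul, Complex.exp_zero, mul_one, abs_zero, add_zero] at h
    push_cast
    push_cast at h
    refine h.trans ?_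
    gcongr
  have hJ0 : 0 ≤ J := integral_nonneg fun r => norm_nonneg _
  refine ⟨‖(1 / (4 * (Real.pi : ℂ) ^ 2))‖ * ((k + 2) * (2 * Real.pi) ^ k * J) + 1, by positivity,
    fun y hy => ?_⟩
  set x := 2 * Real.pi * y with hx
  have hx0 : 0 < x := by positivity
  have hexpint : Integrable fun r : ℝ =>
      spectralFourier H r * (Real.exp (-(x * Real.cosh r)) : ℂ) := by
    refine integrable_spectralFourier_mul hH (L := 1) zero_le_one (by
      have := (Nat.cast_nonneg k : (0:ℝ) ≤ k); linarith)
      (by fun_prop) (A := 1) (M := 0) one_pos fun r => ?_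
    rw [Complex.norm_real, Real.norm_of_nonneg (Real.exp_pos _).le]
    simp
    have := Real.cosh_pos r
    positivity
  have hmom : ∀ j ∈ Finset.range k, ∫ r : ℝ, spectralFourier H r *
      (((-(x * Real.cosh r)) ^ j / (j.factorial : ℝ) : ℝ) : ℂ) = 0 := by
    intro j hj
    have hj' : (j : ℝ) + 1 < 2 * η := by
      have : (j : ℝ) ≤ k := by exact_mod_cast (Finset.mem_range.mp hj).le
      linarith
    have h := integral_spectralFourier_mul_cosh_pow hH j 0 (by simpa using hj')
    have h2 : ∀ r : ℝ, spectralFourier H r *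
        (((-(x * Real.cosh r)) ^ j / (j.factorial : ℝ) : ℝ) : ℂ) =
        ((-x) ^ j / (j.factorial : ℂ)) * (spectralFourier H r *
          ((Real.cosh r : ℂ) ^ j * Complex.exp ((0 : ℤ) * r))) := by
      intro r
      rw [← neg_mul, mul_pow]
      push_cast
      simp
      ring
    rw [integral_congr_ae (Filter.Eventually.of_forall h2), integral_const_mul, h, mul_zero]
  have hmomint : ∀ j ∈ Finset.range k, Integrable fun r : ℝ => spectralFourier H r *
      (((-(x * Real.cosh r)) ^ j / (j.factorial : ℝ) : ℝ) : ℂ) := by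
    intro j hj
    refine ((hint j (Finset.mem_range.mp hj).le).const_mul
      ((-x) ^ j / (j.factorial : ℂ))).congr (Filter.Eventually.of_forall fun r => ?_)
    simp only
    rw [← neg_mul, mul_pow]
    push_cast
    ring
  have hrem : ∫ r : ℝ, spectralFourier H r * (Real.exp (-(x * Real.cosh r)) : ℂ) =
      ∫ r : ℝ, spectralFourier H r * ((Real.exp (-(x * Real.cosh r)) -
        ∑ j ∈ Finset.range k, (-(x * Real.cosh r)) ^ j / (j.factorial : ℝ) : ℝ) : ℂ) := by
    have h3 : ∀ r : ℝ, spectralFourier H r * ((Real.exp (-(x * Real.cosh r)) -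
        ∑ j ∈ Finset.range k, (-(x * Real.cosh r)) ^ j / (j.factorial : ℝ) : ℝ) : ℂ) =
        spectralFourier H r * (Real.exp (-(x * Real.cosh r)) : ℂ) -
        ∑ j ∈ Finset.range k, spectralFourier H r *
          (((-(x * Real.cosh r)) ^ j / (j.factorial : ℝ) : ℝ) : ℂ) := by
      intro r
      rw [Complex.ofReal_sub, Complex.ofReal_sum, mul_sub, Finset.mul_sum]
    rw [integral_congr_ae (Filter.Eventually.of_forall h3),
      integral_sub hexpint (integrable_finsetSum _ hmomint),
      integral_finsetSum _ hmomint, Finset.sum_eq_zero hmom, sub_zero]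
  have hbd : ‖∫ r : ℝ, spectralFourier H r * (Real.exp (-(x * Real.cosh r)) : ℂ)‖ ≤
      (k + 2) * x ^ k * J := by
    rw [hrem, hJ, ← integral_const_mul]
    refine norm_integral_le_of_norm_le ((hint k le_rfl).norm.const_mul _)
      (Filter.Eventually.of_forall fun r => ?_)
    have hc := (Real.cosh_pos r).le
    rw [norm_mul, norm_mul, Complex.norm_real, Complex.norm_real, Real.norm_eq_abs,
      Real.norm_of_nonneg (by positivity : 0 ≤ Real.cosh r ^ k)]
    have h4 := abs_exp_neg_sub_sum_le k (X := x * Real.cosh r) (by positivity)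
    rw [mul_pow] at h4
    calc _ ≤ ‖spectralFourier H r‖ * ((k + 2) * (x ^ k * Real.cosh r ^ k)) := by gcongr
      _ = _ := by ring
  rw [Hflat_eq hH hη hy, norm_mul, norm_mul, norm_neg, Complex.norm_real,
    Real.norm_of_nonneg (Real.sqrt_nonneg y)]
  calc _ ≤ ‖(1 / (4 * (Real.pi : ℂ) ^ 2))‖ * Real.sqrt y * ((k + 2) * x ^ k * J) := by gcongr
    _ = ‖(1 / (4 * (Real.pi : ℂ) ^ 2))‖ * ((k + 2) * (2 * Real.pi) ^ k * J) *
          (Real.sqrt y * y ^ k) := by rw [hx, mul_pow]; ring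
    _ ≤ _ := by gcongr; linarith

lemma continuousOn_Hflat (hH : MemCeta η H) (hη : 1 < η) : ContinuousOn (Hflat H) (Ioi 0) := by
  have hg : Integrable (spectralFourier H) := by
    simpa using integrable_spectralFourier_mul hH (L := 1) zero_le_one (by linarith)
      (φ := fun _ => 1) continuous_const (A := 1) (M := 0) one_pos (fun r => by simp)
  have h1 : ContinuousOn (fun y : ℝ => ∫ r : ℝ, spectralFourier H r *
      (Real.exp (-(2 * Real.pi * y * Real.cosh r)) : ℂ)) (Ioi 0) := by
    refine continuousOn_of_dominated (bound := fun r => ‖spectralFourier H r‖) ?_ ?_ hg.norm ?_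
    · intro y _
      exact hg.1.mul (Continuous.aestronglyMeasurable (by fun_prop))
    · intro y hy
      refine Filter.Eventually.of_forall fun r => ?_
      rw [norm_mul, Complex.norm_real, Real.norm_of_nonneg (Real.exp_pos _).le]
      refine mul_le_of_le_one_right (norm_nonneg _) (Real.exp_le_one_iff.mpr ?_)
      have := Real.cosh_pos r
      have : 0 < y := hy
      have : 0 < 2 * Real.pi * y * Real.cosh r := by positivity
      linarith
    · exact Filter.Eventually.of_forall fun r => by fun_prop
  refine ContinuousOn.congr (f := fun y : ℝ => -(1 / (4 * (Real.pi : ℂ) ^ 2)) *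
    (Real.sqrt y : ℂ) * ∫ r : ℝ, spectralFourier H r *
      (Real.exp (-(2 * Real.pi * y * Real.cosh r)) : ℂ)) ?_
    (fun y hy => Hflat_eq hH (by linarith) hy)
  exact ContinuousOn.mul (Continuous.continuousOn (by fun_prop)) h1

lemma mellinT_eq_mellin (h : ℝ → ℂ) (w : ℂ) : mellinT h w = mellin h w := by
  simp only [mellinT, mellin, smul_eq_mul, mul_comm]

lemma Hflat_isBigO (hH : MemCeta η H) (hη : 1 < η) (k : ℕ) (hk : (k : ℝ) + 1 < 2 * η) :
    LocallyIntegrableOn (Hflat H) (Ioi 0) ∧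
    Hflat H =O[Filter.atTop] (fun y : ℝ => y ^ (-(-(1 / 2) : ℝ))) ∧
    Hflat H =O[nhdsWithin 0 (Ioi 0)] (fun y : ℝ => y ^ (-(-(k + 1 / 2) : ℝ))) := by
  refine ⟨(continuousOn_Hflat hH hη).locallyIntegrableOn measurableSet_Ioi, ?_, ?_⟩
  · obtain ⟨C, -, hC⟩ := norm_Hflat_le hH 0 (by simp; linarith)
    refine Asymptotics.IsBigO.of_bound C ?_
    filter_upwards [Filter.eventually_gt_atTop 0] with y hy
    have := hC y hy
    rwa [pow_zero, mul_one, Real.sqrt_eq_rpow, ← Real.norm_of_nonneg (by positivity : 0 ≤ y ^ (1 / 2 : ℝ)),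
      ← neg_neg (1 / 2 : ℝ)] at this
  · obtain ⟨C, -, hC⟩ := norm_Hflat_le hH k hk
    refine Asymptotics.IsBigO.of_bound C ?_
    filter_upwards [self_mem_nhdsWithin] with y hy
    have hy : 0 < y := hy
    have h1 := hC y hy
    rw [Real.norm_of_nonneg (by positivity), neg_neg, add_comm, Real.rpow_add hy,
      Real.rpow_natCast, ← Real.sqrt_eq_rpow]
    exact h1

lemma differentiableAt_mellinT_Hflat (hH : MemCeta η H) (hη : 1 < η) (k : ℕ)
    (hk : (k : ℝ) + 1 < 2 * η) {w : ℂ} (h1 : -(k : ℝ) ≤ w.re) (h2 : w.re ≤ -1) :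
    DifferentiableAt ℂ (mellinT (Hflat H)) w := by
  obtain ⟨ha, hb, hc⟩ := Hflat_isBigO hH hη k hk
  rw [funext (mellinT_eq_mellin (Hflat H))]
  exact mellin_differentiableAt_of_isBigO_rpow ha hb (by linarith) hc (by linarith)

lemma norm_mellinT_Hflat_le (hH : MemCeta η H) (hη : 1 < η) (k : ℕ) (hk1 : 1 ≤ k)
    (hk : (k : ℝ) + 1 < 2 * η) : ∃ C : ℝ, 0 < C ∧ ∀ w : ℂ, -(k : ℝ) ≤ w.re → w.re ≤ -1 →
      ‖mellinT (Hflat H) w‖ ≤ C := by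
  obtain ⟨ha, hb, hc⟩ := Hflat_isBigO hH hη k hk
  have hk1' : (1:ℝ) ≤ k := by exact_mod_cast hk1
  have i1 : MellinConvergent (Hflat H) (-(k : ℝ) : ℝ) := mellinConvergent_of_isBigO_rpow ha hb
    (by rw [Complex.ofReal_re]; linarith) hc (by rw [Complex.ofReal_re]; linarith)
  have i2 : MellinConvergent (Hflat H) (-1 : ℝ) := mellinConvergent_of_isBigO_rpow ha hb
    (by rw [Complex.ofReal_re]; linarith) hc (by rw [Complex.ofReal_re]; linarith)
  set J := ∫ y in Ioi (0:ℝ), (‖(y : ℂ) ^ (((-(k : ℝ) : ℝ) : ℂ) - 1) • Hflat H y‖ +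
    ‖(y : ℂ) ^ (((-1 : ℝ) : ℂ) - 1) • Hflat H y‖) with hJ
  have hJ0 : 0 ≤ J := integral_nonneg fun y => by positivity
  refine ⟨J + 1, by positivity, fun w h1 h2 => ?_⟩
  rw [mellinT_eq_mellin, mellin]
  refine le_trans (norm_integral_le_of_norm_le (i1.norm.add i2.norm) ?_)
    (le_add_of_nonneg_right zero_le_one)
  refine (ae_restrict_iff' measurableSet_Ioi).mpr (Filter.Eventually.of_forall fun y hy => ?_)
  have hy : 0 < y := hy
  simp only [norm_smul, Complex.norm_cpow_eq_rpow_re_of_pos hy, Complex.sub_re, Complex.ofReal_re,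
    Complex.one_re, Pi.add_apply, ← add_mul]
  gcongr
  rcases le_total y 1 with h | h
  · exact (Real.rpow_le_rpow_of_exponent_ge hy h (by linarith)).trans
      (le_add_of_nonneg_right (by positivity))
  · exact (Real.rpow_le_rpow_of_exponent_le h (by linarith)).trans
      (le_add_of_nonneg_left (by positivity))

end flat

/-! ### Bounds for the Gamma kernel -/

lemma norm_GammaR_le_of_im_near {ε : ℝ} (hε : 0 < ε) (N : ℕ) (hN : 1 ≤ N) {K : ℝ} (hK : 0 ≤ K) :
    ∃ C : ℝ, 0 < C ∧ ∀ (z : ℂ) (y : ℝ), ε ≤ z.re → z.re ≤ 2 * N → |z.im - y| ≤ K →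
      ‖GammaR z‖ ≤ C * (1 + |y|) ^ N * Real.exp (-(Real.pi / 4 * |y|)) := by
  obtain ⟨C, hC, h⟩ := norm_Gamma_le_of_im_near (half_pos hε) N hN hK
  refine ⟨C, hC, fun z y h1 h2 h3 => ?_⟩
  have hre : (z / 2).re = z.re / 2 := by simp
  have him : (z / 2).im = z.im / 2 := by simp
  have h4 := h (z / 2) y (by rw [hre]; linarith) (by rw [hre]; linarith)
    (by rw [him]; convert h3 using 2; ring)
  have h5 : ‖(Real.pi : ℂ) ^ (-z / 2)‖ ≤ 1 := by
    rw [Complex.norm_cpow_eq_rpow_re_of_pos Real.pi_pos]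
    refine Real.rpow_le_one_of_one_le_of_nonpos (by linarith [Real.two_le_pi]) ?_
    rw [neg_div, Complex.neg_re, hre]
    linarith
  rw [GammaR, norm_mul]
  exact (mul_le_of_le_one_left (norm_nonneg _) h5).trans h4

lemma norm_inv_GammaR_le (M : ℕ) :
    ∃ C : ℝ, 0 < C ∧ ∀ (z : ℂ) (y : ℝ), 0 < z.re → z.re ≤ M → z.im = y →
      ‖(GammaR z)⁻¹‖ ≤ C * (1 + |y|) * Real.exp (Real.pi / 4 * |y|) := by
  obtain ⟨C, hC, h⟩ := norm_inv_Gamma_le_of_im_near 0 M le_rfl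
  refine ⟨Real.pi ^ (M : ℝ) * C, by positivity, fun z y h1 h2 h3 => ?_⟩
  have hre : (z / 2).re = z.re / 2 := by simp
  have him : (z / 2).im = z.im / 2 := by simp
  have h4 := h (z / 2) y (by rw [hre]; linarith) (by rw [hre]; simp; linarith)
    (by rw [hre]; linarith) (by rw [him, h3]; simp; ring)
  have h5 : ‖((Real.pi : ℂ) ^ (-z / 2))⁻¹‖ ≤ Real.pi ^ (M : ℝ) := by
    rw [← Complex.cpow_neg, Complex.norm_cpow_eq_rpow_re_of_pos Real.pi_pos]
    refine Real.rpow_le_rpow_of_exponent_le (by linarith [Real.two_le_pi]) ?_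
    rw [neg_div, neg_neg, hre]
    linarith
  rw [GammaR, mul_inv, norm_mul]
  calc _ ≤ Real.pi ^ (M : ℝ) * _ := mul_le_mul h5 h4 (norm_nonneg _) (by positivity)
    _ = _ := by simp; ring

lemma one_add_pow_le_exp (P : ℕ) : ∃ C : ℝ, 0 < C ∧ ∀ X : ℝ, 0 ≤ X →
    (1 + X) ^ P ≤ C * Real.exp (1 / 4 * X) := by
  refine ⟨(P.factorial : ℝ) * 4 ^ P * Real.exp (1 / 4), by positivity, fun X hX => ?_⟩
  have h := Real.pow_div_factorial_le_exp (x := (1 + X) / 4) (by positivity) P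
  rw [div_le_iff₀ (by positivity), div_pow, div_le_iff₀ (by positivity)] at h
  have h2 : Real.exp ((1 + X) / 4) = Real.exp (1 / 4) * Real.exp (1 / 4 * X) := by
    rw [← Real.exp_add]; ring_nf
  rw [h2] at h
  linarith

/-- The balance of the exponential factors of the kernel. -/
lemma kernel_exponent_le (t0 v t1 : ℝ) :
    -3 * |t0 - v| - 3 * |t1| + |t0 - v + t1| - |t0 + v| + |t1 - 2 * t0| ≤
      -(|t0 - v| + |t1|) := by
  have h1 := abs_add_le (t0 - v) t1
  have h2 : |t1 - 2 * t0| ≤ |t1| + (|t0 - v| + |t0 + v|) := by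
    have h3 := abs_sub t1 (2 * t0)
    have h4 := abs_add_le (t0 - v) (t0 + v)
    have h5 : t0 - v + (t0 + v) = 2 * t0 := by ring
    rw [h5] at h4
    linarith
  linarith [abs_nonneg (t0 - v), abs_nonneg t1]

/-- The balance of the polynomial factors of the kernel. -/
lemma kernel_polynomial_le (S m : ℕ) (t0 v t1 : ℝ) :
    ((1 + |t0 - v|) ^ 4 * (1 + |t1|) ^ S) ^ 3 * (1 + |t0 - v + t1|) * (1 + |2 * v|) *
      (1 + |t1 - (t0 - v)|) ^ S * (1 + |t0 + v|) ^ 4 *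
      ((1 + |t1 - 2 * t0|) * ((1 + |t1 - 2 * t0|) ^ m)⁻¹) ≤
    64 * ((1 + |t0|) ^ 6 * ((1 + |t0|) ^ m)⁻¹) *
      ((1 + |t0 - v|) ^ (18 + S) * (1 + |t1|) ^ (4 * S + 2 + m)) := by
  have hx := abs_nonneg (t0 - v)
  have ht := abs_nonneg t1
  have ha := abs_nonneg t0
  have h3 : 1 + |t0 - v + t1| ≤ (1 + |t0 - v|) * (1 + |t1|) := by
    nlinarith [abs_add_le (t0 - v) t1, mul_nonneg hx ht]
  have h6 : 1 + |t1 - (t0 - v)| ≤ (1 + |t0 - v|) * (1 + |t1|) := by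
    nlinarith [abs_sub t1 (t0 - v), mul_nonneg hx ht]
  have h5 : 1 + |2 * v| ≤ 2 * (1 + |t0|) * (1 + |t0 - v|) := by
    have := abs_sub t0 (t0 - v)
    rw [sub_sub_cancel] at this
    rw [abs_mul, abs_two]
    nlinarith [mul_nonneg ha hx]
  have h7 : 1 + |t0 + v| ≤ 2 * (1 + |t0|) * (1 + |t0 - v|) := by
    have h := abs_sub (2 * t0) (t0 - v)
    have e : 2 * t0 - (t0 - v) = t0 + v := by ring
    rw [e, abs_mul, abs_two] at h
    nlinarith [mul_nonneg ha hx]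
  have h8 : 1 + |t1 - 2 * t0| ≤ 2 * (1 + |t0|) * (1 + |t1|) := by
    have h := abs_sub t1 (2 * t0)
    rw [abs_mul, abs_two] at h
    nlinarith [mul_nonneg ha ht]
  have h9 : 1 + |t0| ≤ (1 + |t1 - 2 * t0|) * (1 + |t1|) := by
    have h := abs_sub t1 (t1 - 2 * t0)
    rw [sub_sub_cancel, abs_mul, abs_two] at h
    nlinarith [mul_nonneg (abs_nonneg (t1 - 2 * t0)) ht, abs_nonneg (t1 - 2 * t0)]
  have h10 : ((1 + |t1 - 2 * t0|) ^ m)⁻¹ ≤ ((1 + |t0|) ^ m)⁻¹ * (1 + |t1|) ^ m := by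
    have h11 := pow_le_pow_left₀ (by positivity) h9 m
    rw [mul_pow] at h11
    rw [inv_mul_eq_div, inv_eq_one_div, div_le_div_iff₀ (by positivity) (by positivity)]
    linarith
  set A := 1 + |t0|
  set X := 1 + |t0 - v|
  set Y := 1 + |t1|
  calc _ ≤ (X ^ 4 * Y ^ S) ^ 3 * (X * Y) * (2 * A * X) * (X * Y) ^ S * (2 * A * X) ^ 4 *
        ((2 * A * Y) * ((A ^ m)⁻¹ * Y ^ m)) := by gcongr
    _ = _ := by
      generalize (A ^ m)⁻¹ = B
      rw [mul_pow X Y S, pow_add X, pow_add Y, pow_add Y, pow_mul' Y]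
      ring

lemma norm_GkerPhi_le (α : Fin 3 → ℂ) (hre : ∀ i, (α i).re = 0) {ε : ℝ} (hε : 0 < ε)
    (S m : ℕ) (hS : 15 ≤ S) {T : ℝ} (hT : 0 ≤ T) {δ : ℝ} (hδ : δ = 1 ∨ δ = -1) :
    ∃ C : ℝ, 0 < C ∧ ∀ s0 s s1 u : ℂ, ε ≤ s0.re - u.re → ε ≤ 2 * s.re - s0.re - u.re →
      ε ≤ u.re → u.re ≤ 1 → s.re < 4 → |s.im| < T → 15 ≤ s1.re → s1.re ≤ S →
      (m : ℝ) ≤ (1 + s1.re) / 2 - s0.re →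
      ‖GkerPhi α δ (Real.pi / 2) s1 u s0 s‖ ≤
        C * ((1 + |s0.im|) ^ 6 * ((1 + |s0.im|) ^ m)⁻¹) *
          Real.exp (-(1 / 2 * |s0.im - u.im|)) * Real.exp (-(1 / 2 * |s1.im|)) := by
  have hS1 : 1 ≤ S := by omega
  have hS' : (15:ℝ) ≤ S := by exact_mod_cast hS
  set K : ℝ := ∑ i, |(α i).im| with hK
  have hK0 : 0 ≤ K := Finset.sum_nonneg fun i _ => abs_nonneg _
  have hαK : ∀ i, |(α i).im| ≤ K := fun i =>
    Finset.single_le_sum (f := fun i => |(α i).im|) (fun i _ => abs_nonneg _) (Finset.mem_univ i)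
  obtain ⟨C1, hC1, h1⟩ := norm_GammaR_le_of_im_near hε 4 (by norm_num) hK0
  obtain ⟨C2, hC2, h2⟩ := norm_GammaR_le_of_im_near one_pos S hS1 hK0
  obtain ⟨C3, hC3, h3⟩ := norm_inv_GammaR_le (S + 8)
  obtain ⟨C5, hC5, h5⟩ := norm_Gamma_le_of_im_near hε 1 le_rfl (le_refl (0:ℝ))
  obtain ⟨C6, hC6, h6⟩ := norm_Gamma_le_of_im_near (half_pos hε) S hS1
    (by positivity : 0 ≤ 2 * T)
  obtain ⟨C7, hC7, h7⟩ := norm_Gamma_le_of_im_near (half_pos hε) 4 (by norm_num)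
    (by positivity : 0 ≤ 2 * T)
  obtain ⟨C8, hC8, h8⟩ := norm_inv_Gamma_le_of_im_near m S (le_refl (0:ℝ))
  obtain ⟨D1, hD1, g1⟩ := one_add_pow_le_exp (18 + S)
  obtain ⟨D2, hD2, g2⟩ := one_add_pow_le_exp (4 * S + 2 + m)
  refine ⟨(C1 * C2) ^ 3 * C3 * C5 * C6 * C7 * C8 * 64 * (D1 * D2), by positivity, ?_⟩
  intro s0 s s1 u hr1 hr2 hu hu1 hs hsT hs1 hs1S hm
  have hs0 : s0.re < 8 := by linarith
  set t0 := s0.im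
  set v := u.im
  set t1 := s1.im
  have b1 : ∀ i, ‖GammaR (s0 - u + α i)‖ ≤
      C1 * (1 + |t0 - v|) ^ 4 * Real.exp (-(Real.pi / 4 * |t0 - v|)) := fun i =>
    h1 _ _ (by simp [hre i]; linarith) (by simp [hre i]; linarith) (by simpa [t0, v] using hαK i)
  have b2 : ∀ i, ‖GammaR (s1 - α i)‖ ≤
      C2 * (1 + |t1|) ^ S * Real.exp (-(Real.pi / 4 * |t1|)) := fun i =>
    h2 _ _ (by simp [hre i]; linarith) (by simp [hre i]; linarith) (by simpa [t1] using hαK i)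
  have b3 : ‖(GammaR (s0 - u + s1))⁻¹‖ ≤
      C3 * (1 + |t0 - v + t1|) * Real.exp (Real.pi / 4 * |t0 - v + t1|) :=
    h3 _ _ (by simp; linarith) (by simp; linarith) (by simp [t0, v, t1])
  have b4 : ‖(2 * (Real.pi : ℂ)) ^ (-u)‖ ≤ 1 := by
    have : (2 * (Real.pi : ℂ)) = ((2 * Real.pi : ℝ) : ℂ) := by push_cast; rfl
    rw [this, Complex.norm_cpow_eq_rpow_re_of_pos (by positivity)]
    exact Real.rpow_le_one_of_one_le_of_nonpos (by linarith [Real.two_le_pi]) (by simp; linarith)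
  have b4' : ‖Complex.exp (Complex.I * δ * ((Real.pi / 2 : ℝ) : ℂ) * u)‖ ≤
      Real.exp (Real.pi / 4 * |2 * v|) := by
    have e : (Complex.I * δ * ((Real.pi / 2 : ℝ) : ℂ) * u).re = -(δ * v) * (Real.pi / 2) := by
      have : Complex.I * δ * ((Real.pi / 2 : ℝ) : ℂ) * u =
          ((δ * (Real.pi / 2) : ℝ) : ℂ) * (Complex.I * u) := by push_cast; ring
      rw [this, Complex.re_ofReal_mul, Complex.I_mul_re]
      ring
    rw [Complex.norm_exp, e]
    refine Real.exp_le_exp.mpr ?_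
    have : -(δ * v) ≤ |v| := by
      rcases hδ with rfl | rfl
      · simpa using neg_le_abs v
      · simpa using le_abs_self v
    rw [abs_mul, abs_two]
    nlinarith [Real.pi_pos]
  have b5 : ‖Complex.Gamma u‖ ≤
      C5 * (1 + |2 * v|) ^ 1 * Real.exp (-(Real.pi / 4 * |2 * v|)) :=
    h5 _ _ hu (by simpa using hu1) (by simp [v])
  have b6 : ‖Complex.Gamma ((u + 1 - 2 * s + s1 - s0) / 2)‖ ≤
      C6 * (1 + |t1 - (t0 - v)|) ^ S := by
    have e1 : ((u + 1 - 2 * s + s1 - s0) / 2).re =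
        (u.re + 1 - 2 * s.re + s1.re - s0.re) / 2 := by simp
    have e2 : ((u + 1 - 2 * s + s1 - s0) / 2).im = (v - 2 * s.im + t1 - t0) / 2 := by
      simp [v, t1, t0]
    refine (h6 _ (t1 - (t0 - v)) (by rw [e1]; linarith) (by rw [e1]; linarith) ?_).trans
      (mul_le_of_le_one_right (by positivity) (Real.exp_le_one_iff.mpr ?_))
    · rw [e2]
      have : 2 * ((v - 2 * s.im + t1 - t0) / 2) - (t1 - (t0 - v)) = -(2 * s.im) := by ring
      rw [this, abs_neg, abs_mul, abs_two]
      linarith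
    · have := Real.pi_pos
      have := abs_nonneg (t1 - (t0 - v))
      rw [neg_nonpos]
      positivity
  have b7 : ‖Complex.Gamma ((2 * s - s0 - u) / 2)‖ ≤
      C7 * (1 + |t0 + v|) ^ 4 * Real.exp (-(Real.pi / 4 * |t0 + v|)) := by
    have e1 : ((2 * s - s0 - u) / 2).re = (2 * s.re - s0.re - u.re) / 2 := by simp
    have e2 : ((2 * s - s0 - u) / 2).im = (2 * s.im - t0 - v) / 2 := by simp [v, t0]
    have := h7 ((2 * s - s0 - u) / 2) (-(t0 + v)) (by rw [e1]; linarith)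
      (by rw [e1]; push_cast; linarith) (by
        rw [e2]
        have : 2 * ((2 * s.im - t0 - v) / 2) - -(t0 + v) = 2 * s.im := by ring
        rw [this, abs_mul, abs_two]
        linarith)
    rwa [abs_neg] at this
  have b8 : ‖(Complex.Gamma ((1 + s1) / 2 - s0))⁻¹‖ ≤
      C8 * ((1 + |t1 - 2 * t0|) * ((1 + |t1 - 2 * t0|) ^ m)⁻¹) *
        Real.exp (Real.pi / 4 * |t1 - 2 * t0|) := by
    have e1 : ((1 + s1) / 2 - s0).re = (1 + s1.re) / 2 - s0.re := by simp
    have e2 : ((1 + s1) / 2 - s0).im = t1 / 2 - t0 := by simp [t1, t0]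
    refine h8 _ _ (by rw [e1]; linarith) (by rw [e1]; exact hm) (by rw [e1]; linarith) ?_
    rw [e2]
    have : 2 * (t1 / 2 - t0) - (t1 - 2 * t0) = 0 := by ring
    simp [this]
  have bG : ‖Gfun α (s0 - u) s1‖ ≤
      ((C1 * (1 + |t0 - v|) ^ 4 * Real.exp (-(Real.pi / 4 * |t0 - v|))) *
        (C2 * (1 + |t1|) ^ S * Real.exp (-(Real.pi / 4 * |t1|)))) ^ 3 *
      (C3 * (1 + |t0 - v + t1|) * Real.exp (Real.pi / 4 * |t0 - v + t1|)) := by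
    rw [Gfun, div_eq_mul_inv, norm_mul, norm_prod]
    gcongr
    refine (Finset.prod_le_prod (fun i _ => norm_nonneg _)
      (g := fun _ => (C1 * (1 + |t0 - v|) ^ 4 * Real.exp (-(Real.pi / 4 * |t0 - v|))) *
        (C2 * (1 + |t1|) ^ S * Real.exp (-(Real.pi / 4 * |t1|)))) fun i _ => ?_).trans_eq
      (by simp)
    rw [norm_mul]
    gcongr
    · exact b1 i
    · exact b2 i
  have hexp : (Real.exp (-(Real.pi / 4 * |t0 - v|)) * Real.exp (-(Real.pi / 4 * |t1|))) ^ 3 *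
      Real.exp (Real.pi / 4 * |t0 - v + t1|) * (Real.exp (Real.pi / 4 * |2 * v|) *
      Real.exp (-(Real.pi / 4 * |2 * v|))) * Real.exp (-(Real.pi / 4 * |t0 + v|)) *
      Real.exp (Real.pi / 4 * |t1 - 2 * t0|) ≤
      Real.exp (-(3 / 4 * |t0 - v|)) * Real.exp (-(3 / 4 * |t1|)) := by
    simp only [← Real.exp_add, ← Real.exp_nat_mul]
    refine Real.exp_le_exp.mpr ?_
    have h := mul_le_mul_of_nonneg_left (kernel_exponent_le t0 v t1)
      (by positivity : 0 ≤ Real.pi / 4)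
    have h3 : 3 / 4 * (|t0 - v| + |t1|) ≤ Real.pi / 4 * (|t0 - v| + |t1|) := by
      gcongr
      exact Real.pi_gt_three.le
    push_cast
    linarith
  have hpoly := kernel_polynomial_le S m t0 v t1
  have hsplit : ∀ X : ℝ, Real.exp (1 / 4 * X) * Real.exp (-(3 / 4 * X)) =
      Real.exp (-(1 / 2 * X)) := fun X => by rw [← Real.exp_add]; ring_nf
  rw [GkerPhi, div_eq_mul_inv]
  simp only [norm_mul] at *
  calc _ ≤ ((C1 * (1 + |t0 - v|) ^ 4 * Real.exp (-(Real.pi / 4 * |t0 - v|))) *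
        (C2 * (1 + |t1|) ^ S * Real.exp (-(Real.pi / 4 * |t1|)))) ^ 3 *
      (C3 * (1 + |t0 - v + t1|) * Real.exp (Real.pi / 4 * |t0 - v + t1|)) * 1 *
      Real.exp (Real.pi / 4 * |2 * v|) *
      (C5 * (1 + |2 * v|) ^ 1 * Real.exp (-(Real.pi / 4 * |2 * v|))) *
      (C6 * (1 + |t1 - (t0 - v)|) ^ S) *
      (C7 * (1 + |t0 + v|) ^ 4 * Real.exp (-(Real.pi / 4 * |t0 + v|))) *
      (C8 * ((1 + |t1 - 2 * t0|) * ((1 + |t1 - 2 * t0|) ^ m)⁻¹) *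
        Real.exp (Real.pi / 4 * |t1 - 2 * t0|)) := by gcongr
    _ = ((C1 * C2) ^ 3 * C3 * C5 * C6 * C7 * C8) *
      (((1 + |t0 - v|) ^ 4 * (1 + |t1|) ^ S) ^ 3 * (1 + |t0 - v + t1|) * (1 + |2 * v|) *
      (1 + |t1 - (t0 - v)|) ^ S * (1 + |t0 + v|) ^ 4 *
      ((1 + |t1 - 2 * t0|) * ((1 + |t1 - 2 * t0|) ^ m)⁻¹)) *
      ((Real.exp (-(Real.pi / 4 * |t0 - v|)) * Real.exp (-(Real.pi / 4 * |t1|))) ^ 3 *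
      Real.exp (Real.pi / 4 * |t0 - v + t1|) * (Real.exp (Real.pi / 4 * |2 * v|) *
      Real.exp (-(Real.pi / 4 * |2 * v|))) * Real.exp (-(Real.pi / 4 * |t0 + v|)) *
      Real.exp (Real.pi / 4 * |t1 - 2 * t0|)) := by ring
    _ ≤ ((C1 * C2) ^ 3 * C3 * C5 * C6 * C7 * C8) *
      (64 * ((1 + |t0|) ^ 6 * ((1 + |t0|) ^ m)⁻¹) *
        ((D1 * Real.exp (1 / 4 * |t0 - v|)) * (D2 * Real.exp (1 / 4 * |t1|)))) *
      (Real.exp (-(3 / 4 * |t0 - v|)) * Real.exp (-(3 / 4 * |t1|))) := by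
        refine mul_le_mul (mul_le_mul_of_nonneg_left (hpoly.trans ?_) (by positivity)) hexp
          (by positivity) (by positivity)
        gcongr
        · exact g1 _ (abs_nonneg _)
        · exact g2 _ (abs_nonneg _)
    _ = (C1 * C2) ^ 3 * C3 * C5 * C6 * C7 * C8 * 64 * (D1 * D2) *
        ((1 + |t0|) ^ 6 * ((1 + |t0|) ^ m)⁻¹) *
        (Real.exp (1 / 4 * |t0 - v|) * Real.exp (-(3 / 4 * |t0 - v|))) *
        (Real.exp (1 / 4 * |t1|) * Real.exp (-(3 / 4 * |t1|))) := by ring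
    _ = _ := by rw [hsplit, hsplit]

lemma differentiableAt_Gamma_of_re_pos {z : ℂ} (hz : 0 < z.re) :
    DifferentiableAt ℂ Complex.Gamma z := by
  refine Complex.differentiableAt_Gamma _ fun m h => ?_
  have := congrArg Complex.re h
  simp at this
  linarith [Nat.cast_nonneg (α := ℝ) m]

lemma differentiableAt_GammaR {z : ℂ} (hz : 0 < z.re) : DifferentiableAt ℂ GammaR z := by
  have hπ : (Real.pi : ℂ) ≠ 0 := by exact_mod_cast Real.pi_ne_zero
  have hg : DifferentiableAt ℂ Complex.Gamma (z / 2) :=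
    differentiableAt_Gamma_of_re_pos (by simpa using hz)
  have h1 : DifferentiableAt ℂ (fun z : ℂ => (Real.pi : ℂ) ^ (-z / 2)) z :=
    DifferentiableAt.const_cpow (by fun_prop) (Or.inl hπ)
  exact h1.mul (hg.comp z (by fun_prop : DifferentiableAt ℂ (fun z : ℂ => z / 2) z))

lemma GammaR_ne_zero {z : ℂ} (hz : 0 < z.re) : GammaR z ≠ 0 := by
  have hπ : (Real.pi : ℂ) ≠ 0 := by exact_mod_cast Real.pi_ne_zero
  refine mul_ne_zero (by simp [Complex.cpow_eq_zero_iff, hπ]) ?_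
  exact Complex.Gamma_ne_zero_of_re_pos (by simpa using hz)

/-- The kernel is jointly holomorphic in `(s₁, u)` where all Gamma arguments lie in the right
half plane. -/
lemma differentiableAt_GkerPhi {α : Fin 3 → ℂ} (hre : ∀ i, (α i).re = 0) (δ φ : ℝ) {s0 s : ℂ}
    {p : ℂ × ℂ} (h1 : 0 < s0.re - p.2.re) (h2 : 0 < 2 * s.re - s0.re - p.2.re)
    (h3 : 0 < p.2.re) (h4 : 0 < p.1.re)
    (h5 : 0 < p.2.re + 1 - 2 * s.re + p.1.re - s0.re) :
    DifferentiableAt ℂ (fun p : ℂ × ℂ => GkerPhi α δ φ p.1 p.2 s0 s) p := by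
  have hπ : (2 * (Real.pi : ℂ)) ≠ 0 := by
    simp [Real.pi_ne_zero]
  have gR : ∀ {f : ℂ × ℂ → ℂ}, DifferentiableAt ℂ f p → 0 < (f p).re →
      DifferentiableAt ℂ (fun p => GammaR (f p)) p := fun {f} hf h =>
    (differentiableAt_GammaR h).comp p hf
  have g : ∀ {f : ℂ × ℂ → ℂ}, DifferentiableAt ℂ f p → 0 < (f p).re →
      DifferentiableAt ℂ (fun p => Complex.Gamma (f p)) p := fun {f} hf h =>
    (differentiableAt_Gamma_of_re_pos h).comp p hf
  have hG : DifferentiableAt ℂ (fun p : ℂ × ℂ => Gfun α (s0 - p.2) p.1) p := by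
    have hd := gR (f := fun p : ℂ × ℂ => s0 - p.2 + p.1) (by fun_prop) (by simp; linarith)
    have hi := hd.fun_inv (GammaR_ne_zero (by simp; linarith))
    have hp : ∀ i, DifferentiableAt ℂ
        (fun p : ℂ × ℂ => GammaR (s0 - p.2 + α i) * GammaR (p.1 - α i)) p := fun i =>
      (gR (f := fun p : ℂ × ℂ => s0 - p.2 + α i) (by fun_prop)
        (by simp [hre i]; linarith)).fun_mul
        (gR (f := fun p : ℂ × ℂ => p.1 - α i) (by fun_prop) (by simp [hre i]; linarith))
    simpa only [Gfun, Fin.prod_univ_three, div_eq_mul_inv] using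
      (((hp 0).fun_mul (hp 1)).fun_mul (hp 2)).fun_mul hi
  have hc : DifferentiableAt ℂ (fun p : ℂ × ℂ => (2 * (Real.pi : ℂ)) ^ (-p.2)) p :=
    DifferentiableAt.const_cpow (by fun_prop) (Or.inl hπ)
  have he : DifferentiableAt ℂ (fun p : ℂ × ℂ => Complex.exp (Complex.I * δ * φ * p.2)) p := by
    fun_prop
  have h7 := g (f := fun p : ℂ × ℂ => p.2) (by fun_prop) h3
  have h8 := g (f := fun p : ℂ × ℂ => (p.2 + 1 - 2 * s + p.1 - s0) / 2) (by fun_prop)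
    (by simp; linarith)
  have h9 := g (f := fun p : ℂ × ℂ => (2 * s - s0 - p.2) / 2) (by fun_prop) (by simp; linarith)
  have hd := g (f := fun p : ℂ × ℂ => (1 + p.1) / 2 - s0) (by fun_prop) (by simp; linarith)
  have hi := hd.fun_inv (Complex.Gamma_ne_zero_of_re_pos (by simp; linarith))
  unfold GkerPhi
  simp only [div_eq_mul_inv _ (Complex.Gamma _)]
  exact (((((hG.fun_mul hc).fun_mul he).fun_mul h7).fun_mul h8).fun_mul h9).fun_mul hi

/-- Moving both contours of a double integral over vertical lines, exchanging the order of
integration. -/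
lemma integral_integral_vertical_line_eq {F : ℂ × ℂ → ℂ} {a b c d C κ : ℝ} (hab : a ≤ b)
    (hcd : c ≤ d) (hκ : 0 < κ)
    (hF : ∀ p : ℂ × ℂ, a ≤ p.1.re → p.1.re ≤ b → c ≤ p.2.re → p.2.re ≤ d →
      DifferentiableAt ℂ F p)
    (hbd : ∀ p : ℂ × ℂ, a ≤ p.1.re → p.1.re ≤ b → c ≤ p.2.re → p.2.re ≤ d →
      ‖F p‖ ≤ C * Real.exp (-(κ * |p.1.im|)) * Real.exp (-(κ * |p.2.im|))) :
    ∫ t : ℝ, ∫ v : ℝ, F (a + t * I, d + v * I) = ∫ v : ℝ, ∫ t : ℝ, F (b + t * I, c + v * I) := by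
  have hu : ∀ t : ℝ, ∫ v : ℝ, F (a + t * I, d + v * I) = ∫ v : ℝ, F (a + t * I, c + v * I) := by
    intro t
    refine (integral_vertical_line_eq (f := fun u => F (a + t * I, u))
      (C := C * Real.exp (-(κ * |t|))) hcd hκ (fun z h1 h2 => ?_) fun z h1 h2 => ?_).symm
    · have := hF ((a + t * I : ℂ), z) (by simp) (by simpa using hab) h1 h2
      exact this.comp z (by fun_prop : DifferentiableAt ℂ (fun u : ℂ => ((a + t * I : ℂ), u)) z)
    · simpa using hbd ((a + t * I : ℂ), z) (by simp) (by simpa using hab) h1 h2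
  have hs : ∀ v : ℝ, ∫ t : ℝ, F (a + t * I, c + v * I) = ∫ t : ℝ, F (b + t * I, c + v * I) := by
    intro v
    refine integral_vertical_line_eq (f := fun z => F (z, c + v * I))
      (C := C * Real.exp (-(κ * |v|))) hab hκ (fun z h1 h2 => ?_) fun z h1 h2 => ?_
    · have := hF (z, (c + v * I : ℂ)) h1 h2 (by simp) (by simpa using hcd)
      exact this.comp z (by fun_prop : DifferentiableAt ℂ (fun u : ℂ => (u, (c + v * I : ℂ))) z)
    · refine (hbd (z, (c + v * I : ℂ)) h1 h2 (by simp) (by simpa using hcd)).trans_eq ?_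
      simp
      ring
  have hint : Integrable (fun q : ℝ × ℝ => F (a + q.1 * I, c + q.2 * I))
      (volume.prod volume) := by
    have hdom := ((integrable_exp_neg_mul_abs hκ).const_mul C).mul_prod
      (integrable_exp_neg_mul_abs hκ)
    refine hdom.mono' (Continuous.aestronglyMeasurable ?_) (Filter.Eventually.of_forall fun q => ?_)
    · refine continuous_iff_continuousAt.mpr fun q => ?_
      have := (hF ((a + q.1 * I : ℂ), (c + q.2 * I : ℂ)) (by simp) (by simpa using hab) (by simp)
        (by simpa using hcd)).continuousAt
      exact ContinuousAt.comp (f := fun q : ℝ × ℝ => ((a + q.1 * I : ℂ), (c + q.2 * I : ℂ))) this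
        (by fun_prop)
    · simpa using hbd ((a + q.1 * I : ℂ), (c + q.2 * I : ℂ)) (by simp) (by simpa using hab)
        (by simp) (by simpa using hcd)
  simp_rw [hu]
  rw [integral_integral_swap hint]
  simp_rw [hs]

lemma norm_integral_integral_le_of_exp {f : ℝ → ℝ → ℂ} {M t0 κ : ℝ} (hκ : 0 < κ)
    (hf : ∀ v t, ‖f v t‖ ≤ M * Real.exp (-(κ * |t0 - v|)) * Real.exp (-(κ * |t|))) :
    ‖∫ v : ℝ, ∫ t : ℝ, f v t‖ ≤ M * (∫ t : ℝ, Real.exp (-(κ * |t|))) ^ 2 := by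
  have hi := integrable_exp_neg_mul_abs hκ
  set J := ∫ t : ℝ, Real.exp (-(κ * |t|)) with hJ
  have h1 : ∀ v, ‖∫ t : ℝ, f v t‖ ≤ M * J * Real.exp (-(κ * |t0 - v|)) := fun v => by
    refine (norm_integral_le_of_norm_le (hi.const_mul _)
      (Filter.Eventually.of_forall (hf v))).trans_eq ?_
    rw [integral_const_mul, ← hJ]
    ring
  have h2 : Integrable fun v : ℝ => Real.exp (-(κ * |t0 - v|)) := hi.comp_sub_left t0
  refine (norm_integral_le_of_norm_le (h2.const_mul _)
    (Filter.Eventually.of_forall h1)).trans_eq ?_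
  rw [integral_const_mul, integral_sub_left_eq_self (fun v => Real.exp (-(κ * |v|))) volume t0,
    ← hJ]
  ring

lemma one_add_pow_div_pow_le_rpow {x η : ℝ} {n : ℕ} (hx : 1 ≤ x) (hn : 6 ≤ n) (h : η / 2 ≤ n) :
    (1 + x) ^ 6 * ((1 + x) ^ n)⁻¹ ≤ x ^ (8 - η / 2) := by
  have hx0 : 0 < x := by linarith
  have e : (1 + x) ^ 6 * ((1 + x) ^ n)⁻¹ = ((1 + x) ^ (n - 6))⁻¹ := by
    obtain ⟨k, rfl⟩ := Nat.exists_eq_add_of_le hn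
    rw [Nat.add_sub_cancel_left, pow_add]
    have : 1 + x ≠ 0 := by positivity
    field_simp
  calc (1 + x) ^ 6 * ((1 + x) ^ n)⁻¹ ≤ (x ^ (n - 6))⁻¹ := by
        rw [e]
        gcongr
        linarith
    _ = x ^ (-((n - 6 : ℕ) : ℝ)) := by rw [Real.rpow_neg hx0.le, Real.rpow_natCast]
    _ ≤ x ^ (8 - η / 2) := by
        refine Real.rpow_le_rpow_of_exponent_le hx ?_
        push_cast [hn]
        linarith

/-- Polynomial estimate for the archimedean transform at `φ = π/2`, obtained after
shifting the `s₁`-contour to `Re s₁ = η − 1/2`. -/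
theorem Ftrans_polynomial_bound (η : ℝ) (hη : 40 < η) (H : ℂ → ℂ) (hH : MemCeta η H)
    (α : Fin 3 → ℂ) (hre : ∀ i, (α i).re = 0) (hsum : α 0 + α 1 + α 2 = 0)
    (δ : ℝ) (hδ : δ = 1 ∨ δ = -1) (T : ℝ) (hT : 1000 ≤ T) :
    ∃ B C T0 : ℝ, 0 < B ∧ 0 < C ∧ 2 ≤ T0 ∧ ∀ s0 s : ℂ,
      1/100 < s0.re → s.re < 4 → 0 < 2 * s.re - s0.re - 1/100 → |s.im| < T →
      T0 ≤ |s0.im| →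
      ‖FtransPhi α δ (Real.pi / 2) H s0 s‖ ≤
        C * |s0.im| ^ (8 - η / 2) * Real.log |s0.im| ^ B := by
  obtain ⟨n, hn1, hn2⟩ : ∃ n : ℕ, η / 2 ≤ n ∧ (n : ℝ) < η / 2 + 1 :=
    ⟨⌈η / 2⌉₊, Nat.le_ceil _, Nat.ceil_lt_add_one (by linarith)⟩
  have hn6 : 6 ≤ n := by
    have : (6 : ℝ) ≤ n := by linarith
    exact_mod_cast this
  obtain ⟨S, hS⟩ : ∃ S : ℕ, S = 2 * n + 15 := ⟨_, rfl⟩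
  have hSr : (S : ℝ) = 2 * n + 15 := by rw [hS]; push_cast; ring
  have hn0 : (0 : ℝ) ≤ n := n.cast_nonneg
  have hη1 : 1 < η := by linarith
  have hk : ((S + 1 : ℕ) : ℝ) + 1 < 2 * η := by push_cast; linarith
  have hT0 : 0 ≤ T := by linarith
  obtain ⟨D, hD, hmel⟩ := norm_mellinT_Hflat_le hH hη1 (S + 1) (by omega) hk
  obtain ⟨C, hC, hker⟩ := norm_GkerPhi_le α hre (by norm_num : (0 : ℝ) < 1 / 200) S n
    (by omega) hT0 hδ
  set J := ∫ t : ℝ, Real.exp (-(1 / 2 * |t|)) with hJ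
  refine ⟨1, D * C * J ^ 2 + 1, 3, one_pos, by positivity, by norm_num, ?_⟩
  intro s0 s hs0 hs hs2 hsT ht0
  have hw : ∀ s1 : ℂ, 15 ≤ s1.re → s1.re ≤ S →
      -((S + 1 : ℕ) : ℝ) ≤ (s - s1 - 1 / 2).re ∧ (s - s1 - 1 / 2).re ≤ -1 := fun s1 h1 h2 => by
    have e : (s - s1 - 1 / 2).re = s.re - s1.re - 1 / 2 := by simp
    rw [e]
    push_cast
    constructor <;> linarith
  set F : ℂ × ℂ → ℂ := fun p =>
    mellinT (Hflat H) (s - p.1 - 1 / 2) * GkerPhi α δ (Real.pi / 2) p.1 p.2 s0 s with hFdef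
  obtain ⟨ε, hε, hε1, hε2, hε3⟩ : ∃ ε : ℝ, 0 < ε ∧ ε ≤ s0.re - 1 / 100 ∧
      ε ≤ 2 * s.re - s0.re - 1 / 100 ∧ ε ≤ 1 / 200 :=
    ⟨min (min (s0.re - 1 / 100) (2 * s.re - s0.re - 1 / 100)) (1 / 200),
      lt_min (lt_min (by linarith) (by linarith)) (by norm_num),
      (min_le_left _ _).trans (min_le_left _ _), (min_le_left _ _).trans (min_le_right _ _),
      min_le_right _ _⟩
  obtain ⟨C', hC', hker'⟩ := norm_GkerPhi_le α hre hε S 0 (by omega) hT0 hδ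
  have hFd : ∀ p : ℂ × ℂ, (15 : ℝ) ≤ p.1.re → p.1.re ≤ S → 1 / 200 ≤ p.2.re →
      p.2.re ≤ 1 / 100 → DifferentiableAt ℂ F p := fun p h1 h2 h3 h4 => by
    have hm := differentiableAt_mellinT_Hflat hH hη1 (S + 1) hk (hw p.1 h1 h2).1 (hw p.1 h1 h2).2
    refine DifferentiableAt.fun_mul (hm.comp p (f := fun p : ℂ × ℂ => s - p.1 - 1 / 2)
      (by fun_prop)) (differentiableAt_GkerPhi hre _ _ ?_ ?_ ?_ ?_ ?_) <;> linarith
  have hFb : ∀ p : ℂ × ℂ, (15 : ℝ) ≤ p.1.re → p.1.re ≤ S → 1 / 200 ≤ p.2.re →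
      p.2.re ≤ 1 / 100 → ‖F p‖ ≤ (D * (C' * (1 + |s0.im|) ^ 6 * Real.exp (1 / 2 * |s0.im|))) *
        Real.exp (-(1 / 2 * |p.1.im|)) * Real.exp (-(1 / 2 * |p.2.im|)) := fun p h1 h2 h3 h4 => by
    have hb := hker' s0 s p.1 p.2 (by linarith) (by linarith) (by linarith) (by linarith) hs hsT
      h1 h2 (by push_cast; linarith)
    have he : Real.exp (-(1 / 2 * |s0.im - p.2.im|)) ≤
        Real.exp (1 / 2 * |s0.im|) * Real.exp (-(1 / 2 * |p.2.im|)) := by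
      rw [← Real.exp_add]
      refine Real.exp_le_exp.mpr ?_
      have := abs_sub s0.im (s0.im - p.2.im)
      rw [sub_sub_cancel] at this
      linarith
    rw [hFdef, norm_mul]
    calc _ ≤ D * (C' * ((1 + |s0.im|) ^ 6 * ((1 + |s0.im|) ^ 0)⁻¹) *
          (Real.exp (1 / 2 * |s0.im|) * Real.exp (-(1 / 2 * |p.2.im|))) *
          Real.exp (-(1 / 2 * |p.1.im|))) := by
          refine mul_le_mul (hmel _ (hw p.1 h1 h2).1 (hw p.1 h1 h2).2) (hb.trans ?_)
            (norm_nonneg _) hD.le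
          gcongr
      _ = _ := by rw [pow_zero]; ring
  have hshift := integral_integral_vertical_line_eq (a := 15) (b := S) (c := 1 / 200)
    (d := 1 / 100) (by rw [hSr]; linarith) (by norm_num) (by norm_num) hFd hFb
  have hfin := norm_integral_integral_le_of_exp (t0 := s0.im)
    (M := D * (C * ((1 + |s0.im|) ^ 6 * ((1 + |s0.im|) ^ n)⁻¹)))
    (f := fun v t => F (((S : ℝ) : ℂ) + t * I, ((1 / 200 : ℝ) : ℂ) + v * I))
    (by norm_num : (0 : ℝ) < 1 / 2) fun v t => by
      have e1 : (((S : ℝ) : ℂ) + t * I).re = S := by simp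
      have e2 : (((1 / 200 : ℝ) : ℂ) + v * I).re = 1 / 200 := by
        rw [Complex.add_re, Complex.ofReal_re]; simp
      have e3 : (((S : ℝ) : ℂ) + t * I).im = t := by simp
      have e4 : (((1 / 200 : ℝ) : ℂ) + v * I).im = v := by
        rw [Complex.add_im, Complex.ofReal_im]; simp
      have hS15 : (15 : ℝ) ≤ (((S : ℝ) : ℂ) + t * I).re := by rw [e1]; linarith
      have hb := hker s0 s (((S : ℝ) : ℂ) + t * I) (((1 / 200 : ℝ) : ℂ) + v * I)
        (by rw [e2]; linarith) (by rw [e2]; linarith) e2.ge (by rw [e2]; norm_num) hs hsT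
        hS15 e1.le (by rw [e1]; linarith)
      rw [e3, e4] at hb
      rw [hFdef, norm_mul]
      refine (mul_le_mul (hmel _ (hw _ hS15 e1.le).1 (hw _ hS15 e1.le).2) hb (norm_nonneg _)
        hD.le).trans_eq (by ring)
  have hFT : FtransPhi α δ (Real.pi / 2) H s0 s = (1 / (2 * (Real.pi : ℂ))) ^ 2 *
      ∫ v : ℝ, ∫ t : ℝ, F (((S : ℝ) : ℂ) + t * I, ((1 / 200 : ℝ) : ℂ) + v * I) := by
    rw [← hshift, FtransPhi, hFdef]
    push_cast
    rfl
  have hpi : ‖(1 / (2 * (Real.pi : ℂ))) ^ 2‖ ≤ 1 := by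
    rw [norm_pow, norm_div, norm_mul, Complex.norm_real, Real.norm_of_nonneg Real.pi_pos.le]
    refine pow_le_one₀ (by positivity) ?_
    rw [norm_one, Complex.norm_ofNat, div_le_one (by positivity)]
    linarith [Real.two_le_pi]
  have hlog : 1 ≤ Real.log |s0.im| ^ (1 : ℝ) := by
    rw [Real.rpow_one, Real.le_log_iff_exp_le (by linarith)]
    linarith [Real.exp_one_lt_d9]
  have hpw := one_add_pow_div_pow_le_rpow (η := η) (by linarith : 1 ≤ |s0.im|) hn6 hn1
  have hR : 0 ≤ |s0.im| ^ (8 - η / 2) := by positivity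
  rw [hFT, norm_mul]
  calc _ ≤ 1 * (D * (C * ((1 + |s0.im|) ^ 6 * ((1 + |s0.im|) ^ n)⁻¹)) * J ^ 2) :=
        mul_le_mul hpi hfin (norm_nonneg _) zero_le_one
    _ ≤ 1 * (D * (C * |s0.im| ^ (8 - η / 2)) * J ^ 2) := by gcongr
    _ ≤ (D * C * J ^ 2 + 1) * |s0.im| ^ (8 - η / 2) * 1 := by linarith
    _ ≤ (D * C * J ^ 2 + 1) * |s0.im| ^ (8 - η / 2) * Real.log |s0.im| ^ (1 : ℝ) := by gcongr
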